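/- arXiv:2407.16679 — 3 statements merged into one kernel-verified Lean document; each statement's English description precedes it below -/
import Mathlib

section
/- For every integer n ≥ 1, the diagonal map Δ : ℝⁿ → ℝⁿ × ℝⁿ, Δ(x) = (x, x), is a proper map with p-secat(Δ) = 1. In particular, Δ admits no proper homotopy section: there is no proper map s : ℝⁿ × ℝⁿ → ℝⁿ with Δ ∘ s properly homotopic to the identity of ℝⁿ × ℝⁿ. -/
open Set unitInterval
open scoped NNReal ENNReal

noncomputable section

universe u v

/-- A proper homotopy between two maps: a continuous map `H : X × [0,1] → Y` which is itself
proper, restricting to `f` at time `0` and to `g` at time `1`. -/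
def ProperlyHomotopic {X : Type*} {Y : Type*} [TopologicalSpace X] [TopologicalSpace Y]
    (f g : X → Y) : Prop :=
  ∃ H : X × unitInterval → Y, IsProperMap H ∧
    (∀ x, H (x, 0) = f x) ∧ (∀ x, H (x, 1) = g x)

/-- An ordinary (unbundled) homotopy between two maps. -/
def Homotopic' {X : Type*} {Y : Type*} [TopologicalSpace X] [TopologicalSpace Y]
    (f g : X → Y) : Prop :=
  ∃ H : X × unitInterval → Y, Continuous H ∧
    (∀ x, H (x, 0) = f x) ∧ (∀ x, H (x, 1) = g x)

/-- A proper homotopy equivalence: a proper map admitting a proper homotopy inverse. -/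
def IsProperHomotopyEquiv {X : Type*} {Y : Type*} [TopologicalSpace X] [TopologicalSpace Y]
    (f : X → Y) : Prop :=
  IsProperMap f ∧ ∃ g : Y → X, IsProperMap g ∧
    ProperlyHomotopic (g ∘ f) (id : X → X) ∧ ProperlyHomotopic (f ∘ g) (id : Y → Y)

/-- `PSecatLE f n`: the proper sectional category of the proper map `f` is at most `n`, i.e.
`Y` admits an open cover by `n + 1` sets, each of whose closures carries a proper map to `X`
whose composition with `f` is properly homotopic to the inclusion. -/
def PSecatLE {X : Type*} {Y : Type*} [TopologicalSpace X] [TopologicalSpace Y]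
    (f : X → Y) (n : ℕ) : Prop :=
  ∃ U : Fin (n + 1) → Set Y, (∀ i, IsOpen (U i)) ∧ (⋃ i, U i) = Set.univ ∧
    ∀ i, ∃ s : closure (U i) → X, IsProperMap s ∧
      ProperlyHomotopic (fun y => f (s y)) (fun y : closure (U i) => (y : Y))

/-- The proper sectional category of a proper map, with value in `ℕ∞`. -/
def pSecat {X : Type*} {Y : Type*} [TopologicalSpace X] [TopologicalSpace Y]
    (f : X → Y) : ℕ∞ :=
  sInf {n : ℕ∞ | ∃ m : ℕ, n = (m : ℕ∞) ∧ PSecatLE f m}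

/-- `SecatLE f n`: the (classical) sectional category of `f` is at most `n`. -/
def SecatLE {X : Type*} {Y : Type*} [TopologicalSpace X] [TopologicalSpace Y]
    (f : X → Y) (n : ℕ) : Prop :=
  ∃ U : Fin (n + 1) → Set Y, (∀ i, IsOpen (U i)) ∧ (⋃ i, U i) = Set.univ ∧
    ∀ i, ∃ s : U i → X, Continuous s ∧
      Homotopic' (fun y => f (s y)) (fun y : U i => (y : Y))

/-- The classical sectional category of a continuous map, with value in `ℕ∞`. -/
def secat {X : Type*} {Y : Type*} [TopologicalSpace X] [TopologicalSpace Y]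
    (f : X → Y) : ℕ∞ :=
  sInf {n : ℕ∞ | ∃ m : ℕ, n = (m : ℕ∞) ∧ SecatLE f m}

/-- `PCatLE α n`: the `α`-proper Lusternik–Schnirelmann category of `X` is at most `n`.
Here `ℝ≥0 = [0,∞)` and `α : [0,∞) → X` is a ray. -/
def PCatLE {X : Type*} [TopologicalSpace X] (α : ℝ≥0 → X) (n : ℕ) : Prop :=
  ∃ U : Fin (n + 1) → Set X, (∀ i, IsOpen (U i)) ∧ (⋃ i, U i) = Set.univ ∧
    ∀ i, ∃ r : closure (U i) → ℝ≥0, IsProperMap r ∧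
      ProperlyHomotopic (fun x : closure (U i) => (x : X)) (fun x => α (r x))

/-- The `α`-proper Lusternik–Schnirelmann category, with value in `ℕ∞`. -/
def pCat {X : Type*} [TopologicalSpace X] (α : ℝ≥0 → X) : ℕ∞ :=
  sInf {n : ℕ∞ | ∃ m : ℕ, n = (m : ℕ∞) ∧ PCatLE α m}

/-- `LSCatLE X n`: the Lusternik–Schnirelmann category of `X` is at most `n`, i.e. `X` admits
an open cover by `n + 1` sets whose inclusions are nullhomotopic. -/
def LSCatLE (X : Type*) [TopologicalSpace X] (n : ℕ) : Prop :=
  ∃ U : Fin (n + 1) → Set X, (∀ i, IsOpen (U i)) ∧ (⋃ i, U i) = Set.univ ∧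
    ∀ i, ∃ x₀ : X, Homotopic' (fun x : U i => (x : X)) (fun _ => x₀)

/-- The Lusternik–Schnirelmann category, with value in `ℕ∞`. -/
def lsCat (X : Type*) [TopologicalSpace X] : ℕ∞ :=
  sInf {n : ℕ∞ | ∃ m : ℕ, n = (m : ℕ∞) ∧ LSCatLE X m}

/-- `TCLE X n`: the topological complexity of `X` is at most `n`: there is an open cover
`U_0, …, U_n` of `X × X` with continuous local sections of the path fibration. -/
def TCLE (X : Type*) [TopologicalSpace X] (n : ℕ) : Prop :=
  ∃ U : Fin (n + 1) → Set (X × X), (∀ i, IsOpen (U i)) ∧ (⋃ i, U i) = Set.univ ∧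
    ∀ i, ∃ s : U i → C(unitInterval, X), Continuous s ∧
      ∀ p : U i, s p 0 = (p : X × X).1 ∧ s p 1 = (p : X × X).2

/-- The topological complexity of `X`, with value in `ℕ∞`. -/
def TC' (X : Type*) [TopologicalSpace X] : ℕ∞ :=
  sInf {n : ℕ∞ | ∃ m : ℕ, n = (m : ℕ∞) ∧ TCLE X m}

/-- `PTCLE X n`: the proper topological complexity of `X` is at most `n`: there is an open
cover `U_0, …, U_n` of `X × X` with continuous local sections `s_i` of the path fibration such
that every compact `K ⊆ X` is contained in a compact `L` with `s_i (x, y) t ∉ K` whenever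
`(x, y) ∈ U_i`, `x ∉ L` and `y ∉ L`. -/
def PTCLE (X : Type*) [TopologicalSpace X] (n : ℕ) : Prop :=
  ∃ U : Fin (n + 1) → Set (X × X), (∀ i, IsOpen (U i)) ∧ (⋃ i, U i) = Set.univ ∧
    ∃ s : (i : Fin (n + 1)) → U i → C(unitInterval, X),
      (∀ i, Continuous (s i)) ∧
      (∀ i (p : U i), s i p 0 = (p : X × X).1 ∧ s i p 1 = (p : X × X).2) ∧
      (∀ K : Set X, IsCompact K → ∃ L : Set X, IsCompact L ∧ K ⊆ L ∧
        ∀ i (p : U i), (p : X × X).1 ∉ L → (p : X × X).2 ∉ L →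
          ∀ t : unitInterval, s i p t ∉ K)

/-- The proper topological complexity of `X`, with value in `ℕ∞`. -/
def pTC (X : Type*) [TopologicalSpace X] : ℕ∞ :=
  sInf {n : ℕ∞ | ∃ m : ℕ, n = (m : ℕ∞) ∧ PTCLE X m}

/-- An ANR: a metrizable space which, whenever embedded as a closed subspace of a metrizable
space, is a retract of an open neighborhood. -/
def IsANR (X : Type u) [TopologicalSpace X] : Prop :=
  TopologicalSpace.MetrizableSpace X ∧
  ∀ (Z : Type u) [TopologicalSpace Z], TopologicalSpace.MetrizableSpace Z →
    ∀ e : X → Z, Topology.IsClosedEmbedding e →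
      ∃ U : Set Z, IsOpen U ∧ Set.range e ⊆ U ∧
        ∃ r : U → X, Continuous r ∧ ∀ (x : X) (h : e x ∈ U), r ⟨e x, h⟩ = x

/-- The wedge `X ∨ Y` of two pointed spaces: the quotient of `X ⊕ Y` identifying the two base
points. -/
abbrev Wedge (X Y : Type*) [TopologicalSpace X] [TopologicalSpace Y] (x₀ : X) (y₀ : Y) :=
  Quot (fun a b : X ⊕ Y => a = Sum.inl x₀ ∧ b = Sum.inr y₀)

section NoRetraction

open MeasureTheory Polynomial

variable {V : Type*} [NormedAddCommGroup V] [NormedSpace ℝ V]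

/-- Gluing a map vanishing on the unit sphere with zero outside the unit ball preserves its
Lipschitz constant. -/
theorem lipschitzWith_indicator_closedBall {C : ℝ≥0} {k : V → V}
    (hk : LipschitzOnWith C k (Metric.closedBall 0 1)) (hk0 : ∀ x, ‖x‖ = 1 → k x = 0) :
    LipschitzWith C ((Metric.closedBall (0 : V) 1).indicator k) := by
  have key : ∀ x y : V, x ∈ Metric.closedBall (0 : V) 1 → y ∉ Metric.closedBall (0 : V) 1 →
      ‖k x‖ ≤ C * dist x y := by
    intro x y hx hy
    have hx' : ‖x‖ ≤ 1 := by simpa using hx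
    have hy' : 1 < ‖y‖ := by simpa using hy
    have hc : ContinuousOn (fun s : ℝ => ‖x + s • (y - x)‖) (Icc 0 1) := by fun_prop
    obtain ⟨s, hs, hs1⟩ := intermediate_value_Icc zero_le_one hc
      (show (1 : ℝ) ∈ Icc _ _ by constructor <;> simp [hx', hy'.le])
    have hz : x + s • (y - x) ∈ Metric.closedBall (0 : V) 1 := by simpa using hs1.le
    have h1 := hk.dist_le_mul x hx _ hz
    rw [hk0 _ hs1, dist_zero_right] at h1
    refine h1.trans (mul_le_mul_of_nonneg_left ?_ C.2)
    rw [dist_eq_norm, dist_comm x y, dist_eq_norm y x, sub_add_cancel_left, norm_neg, norm_smul,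
      Real.norm_of_nonneg hs.1]
    exact mul_le_of_le_one_left (norm_nonneg _) hs.2
  refine LipschitzWith.of_dist_le_mul fun x y => ?_
  by_cases hx : x ∈ Metric.closedBall (0 : V) 1 <;> by_cases hy : y ∈ Metric.closedBall (0 : V) 1
  · simpa only [indicator_of_mem hx, indicator_of_mem hy] using hk.dist_le_mul x hx y hy
  · simpa only [indicator_of_mem hx, indicator_of_notMem hy, dist_zero_right] using key x y hx hy
  · simpa only [indicator_of_mem hy, indicator_of_notMem hx, dist_zero_left, dist_comm x y]
      using key y x hy hx
  · simp only [indicator_of_notMem hx, indicator_of_notMem hy, dist_self]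
    positivity

/-- The identity plus a strict contraction is a bijection of a Banach space. -/
theorem bijective_id_add_of_lipschitzWith [CompleteSpace V] {C : ℝ≥0} (hC : C < 1) {k : V → V}
    (hk : LipschitzWith C k) : Function.Bijective fun x => x + k x := by
  have happ : ApproximatesLinearOn (fun x => x + k x)
      ((ContinuousLinearEquiv.refl ℝ V : V ≃L[ℝ] V) : V →L[ℝ] V) univ C := by
    refine ApproximatesLinearOn.approximatesLinearOn_iff_lipschitzOnWith.2 ?_
    convert hk.lipschitzOnWith (s := univ) using 1
    ext x
    simp
  have hc : Subsingleton V ∨ C < ‖((ContinuousLinearEquiv.refl ℝ V).symm : V →L[ℝ] V)‖₊⁻¹ := by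
    rcases subsingleton_or_nontrivial V with h | h
    · exact Or.inl h
    · right
      have : ‖((ContinuousLinearEquiv.refl ℝ V).symm : V →L[ℝ] V)‖₊ = 1 :=
        NNReal.eq ContinuousLinearMap.norm_id
      rwa [this, inv_one]
  exact ⟨injOn_univ.1 (happ.injOn hc), happ.surjective hc⟩

variable [FiniteDimensional ℝ V]

theorem ContinuousLinearMap.det_id_add_pos (A : V →L[ℝ] V) (hA : ‖A‖ < 1) :
    0 < (ContinuousLinearMap.id ℝ V + A).det := by
  have hne : ∀ t ∈ Icc (0 : ℝ) 1, (ContinuousLinearMap.id ℝ V + t • A).det ≠ 0 := by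
    intro t ht h0
    obtain ⟨v, hv, hv0⟩ := SetLike.exists_of_lt (LinearMap.bot_lt_ker_of_det_eq_zero h0)
    have hv0' : 0 < ‖v‖ := norm_pos_iff.2 (by simpa using hv0)
    have hv' : v + t • A v = 0 := by simpa using hv
    have h1 : ‖v‖ = t * ‖A v‖ := by
      rw [eq_neg_of_add_eq_zero_left hv', norm_neg, norm_smul, Real.norm_of_nonneg ht.1,
        ← eq_neg_of_add_eq_zero_left hv']
    have h2 : ‖v‖ ≤ ‖A‖ * ‖v‖ :=
      h1.trans_le ((mul_le_of_le_one_left (norm_nonneg _) ht.2).trans (A.le_opNorm v))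
    nlinarith
  by_contra hneg
  have hc : ContinuousOn (fun t : ℝ => (ContinuousLinearMap.id ℝ V + t • A).det) (Icc 0 1) :=
    (ContinuousLinearMap.continuous_det.comp (by fun_prop)).continuousOn
  obtain ⟨t, ht, h0⟩ := intermediate_value_Icc' zero_le_one hc
    (show (0 : ℝ) ∈ Icc _ _ from
      ⟨by simpa using hneg, by simp [ContinuousLinearMap.det]⟩)
  exact hne t ht h0

theorem ContinuousLinearMap.exists_polynomial_eval_eq_det (A : V →L[ℝ] V) :
    ∃ p : ℝ[X], p.natDegree ≤ Module.finrank ℝ V ∧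
      ∀ t : ℝ, p.eval t = (ContinuousLinearMap.id ℝ V + t • A).det := by
  let b := Module.finBasis ℝ V
  let M := LinearMap.toMatrix b b (A : V →ₗ[ℝ] V)
  refine ⟨((X : ℝ[X]) • M.map C + (1 : Matrix _ _ ℝ).map C).det, ?_, fun t => ?_⟩
  · simpa using natDegree_det_X_add_C_le M 1
  · rw [ContinuousLinearMap.det, ← LinearMap.det_toMatrix b, ← coe_evalRingHom, RingHom.map_det]
    congr 1
    ext i j
    simp [M, LinearMap.toMatrix_apply, Matrix.one_apply, Finsupp.single_apply, add_comm, eq_comm,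
      apply_ite, mul_comm t]

/-- If the integral of `det (1 + t • A x)` does not depend on `t` for small `t ≥ 0`, then it has the
same value at `t = 1`, the integrand being polynomial in `t`. -/
theorem integral_det_id_add_eq [MeasurableSpace V] {μ : Measure V} {A : V → V →L[ℝ] V} {c d : ℝ}
    (hc : 0 ≤ c)
    (hint : ∀ t : ℝ, Integrable (fun x => (ContinuousLinearMap.id ℝ V + t • A x).det) μ)
    (h : ∀ t : ℝ, 0 ≤ t → t * c < 1 →
      ∫ x, (ContinuousLinearMap.id ℝ V + t • A x).det ∂μ = d) :
    ∫ x, (ContinuousLinearMap.id ℝ V + A x).det ∂μ = d := by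
  set m := Module.finrank ℝ V
  set s := Finset.range (m + 1)
  let v : ℕ → ℝ := fun i => i / ((c + 1) * (m + 1))
  have hpos : 0 < (c + 1) * ((m : ℝ) + 1) := by positivity
  have hv : InjOn v s := by
    intro i _ j _ hij
    simpa [v, div_left_inj' hpos.ne'] using hij
  have hvc : ∀ i ∈ s, v i * c < 1 := by
    intro i hi
    have hi' : (i : ℝ) < m + 1 := by exact_mod_cast Finset.mem_range.1 hi
    rw [div_mul_eq_mul_div, div_lt_one hpos]
    have : (0 : ℝ) ≤ i := Nat.cast_nonneg i
    nlinarith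
  have hexp : ∀ x, (ContinuousLinearMap.id ℝ V + A x).det =
      ∑ i ∈ s, (ContinuousLinearMap.id ℝ V + v i • A x).det * (Lagrange.basis s v i).eval 1 := by
    intro x
    obtain ⟨p, hp, hpe⟩ := (A x).exists_polynomial_eval_eq_det
    have hdeg : p.degree < s.card := by
      refine (degree_le_of_natDegree_le hp).trans_lt ?_
      rw [Finset.card_range]
      exact_mod_cast Nat.lt_succ_self m
    have h1 := hpe 1
    rw [one_smul, Lagrange.eq_interpolate hv hdeg, Lagrange.interpolate_apply,
      eval_finsetSum] at h1
    rw [← h1]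
    simp [hpe]
  simp_rw [hexp]
  rw [integral_finsetSum _ fun i _ => (hint _).mul_const _]
  have hsum : ∑ i ∈ s, (Lagrange.basis s v i).eval 1 = 1 := by
    rw [← eval_finsetSum, Lagrange.sum_basis hv (by simp [s]), eval_one]
  calc _ = ∑ i ∈ s, d * (Lagrange.basis s v i).eval 1 := by
        refine Finset.sum_congr rfl fun i hi => ?_
        rw [integral_mul_const, h _ (by positivity) (hvc i hi)]
    _ = d := by rw [← Finset.mul_sum, hsum, mul_one]

end NoRetraction

section

variable {V : Type*} [NormedAddCommGroup V] [InnerProductSpace ℝ V] [FiniteDimensional ℝ V]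

open MeasureTheory

/-- There is no `C¹` retraction of the closed unit ball onto the unit sphere. -/
theorem not_exists_contDiff_retraction (r : V → V) (hr : ContDiff ℝ 1 r) (hr1 : ∀ x, ‖r x‖ = 1)
    (hrs : ∀ x, ‖x‖ = 1 → r x = x) : False := by
  borelize V
  let μ : Measure V := Measure.addHaar
  let B := Metric.ball (0 : V) 1
  let k : V → V := fun x => r x - x
  have hk : ContDiff ℝ 1 k := hr.sub contDiff_id
  have hkd : Differentiable ℝ k := hk.differentiable one_ne_zero
  have hkc : Continuous (fderiv ℝ k) := hk.continuous_fderiv one_ne_zero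
  obtain ⟨c, hc⟩ : ∃ c : ℝ≥0, ∀ x ∈ Metric.closedBall (0 : V) 1, ‖fderiv ℝ k x‖₊ ≤ c := by
    obtain ⟨c, hc⟩ := (isCompact_closedBall (0 : V) 1).exists_bound_of_continuousOn hkc.continuousOn
    exact ⟨c.toNNReal, fun x hx => NNReal.le_toNNReal_of_coe_le (hc x hx)⟩
  have hlip : LipschitzWith c ((Metric.closedBall (0 : V) 1).indicator k) :=
    lipschitzWith_indicator_closedBall
      ((convex_closedBall _ _).lipschitzOnWith_of_nnnorm_fderiv_le (fun x _ => hkd x) hc)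
      fun x hx => sub_eq_zero.2 (hrs x hx)
  have hint : ∀ t : ℝ, Integrable
      (fun x => (ContinuousLinearMap.id ℝ V + t • fderiv ℝ k x).det) (μ.restrict B) := fun t =>
    ((ContinuousLinearMap.continuous_det.comp (by fun_prop)).continuousOn.integrableOn_compact
      (isCompact_closedBall (0 : V) 1)).mono_set Metric.ball_subset_closedBall
  have hvol : ∀ t : ℝ, 0 ≤ t → t * c < 1 →
      ∫ x in B, (ContinuousLinearMap.id ℝ V + t • fderiv ℝ k x).det ∂μ = μ.real B := by
    intro t ht htc
    lift t to ℝ≥0 using ht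
    have htc' : t * c < 1 := by exact_mod_cast htc
    let F : V → V := fun x => x + t • (Metric.closedBall (0 : V) 1).indicator k x
    have hbij : Function.Bijective F := by
      refine bijective_id_add_of_lipschitzWith htc' (LipschitzWith.of_dist_le_mul fun x y => ?_)
      rw [NNReal.smul_def, NNReal.smul_def, dist_smul₀, Real.norm_of_nonneg t.coe_nonneg,
        NNReal.coe_mul, mul_assoc]
      exact mul_le_mul_of_nonneg_left (hlip.dist_le_mul x y) t.2
    have hFout : EqOn F id Bᶜ := by
      intro x hx
      have hx' : 1 ≤ ‖x‖ := by simpa [B] using hx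
      rcases hx'.eq_or_lt with h | h
      · simp [F, indicator, k, hrs x h.symm]
      · simp [F, indicator, h.not_ge]
    have himg : F '' B = B := by
      rw [← compl_inj_iff, ← image_compl_eq hbij, hFout.image_eq, image_id]
    have hder : ∀ x ∈ B, HasFDerivWithinAt F
        (ContinuousLinearMap.id ℝ V + (t : ℝ) • fderiv ℝ k x) B x := by
      intro x hx
      have h1 : HasFDerivWithinAt (fun x => x + (t : ℝ) • k x)
        (ContinuousLinearMap.id ℝ V + (t : ℝ) • fderiv ℝ k x) B x :=
        ((hasFDerivAt_id x).add ((hkd x).hasFDerivAt.const_smul (t : ℝ))).hasFDerivWithinAt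
      refine h1.congr' (fun y hy => ?_) hx
      simp [F, indicator_of_mem (Metric.ball_subset_closedBall hy), NNReal.smul_def]
    have h := integral_image_eq_integral_abs_det_fderiv_smul μ Metric.isOpen_ball.measurableSet
      hder hbij.injective.injOn (fun _ => (1 : ℝ))
    rw [himg] at h
    simp only [smul_eq_mul, mul_one, integral_const, MeasurableSet.univ, measureReal_restrict_apply,
      univ_inter] at h
    rw [h]
    refine setIntegral_congr_fun Metric.isOpen_ball.measurableSet fun x hx => ?_
    refine (abs_of_pos (ContinuousLinearMap.det_id_add_pos _ ?_)).symm
    rw [norm_smul, Real.norm_of_nonneg t.coe_nonneg]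
    have hcx : ‖fderiv ℝ k x‖ ≤ (c : ℝ) := hc x (Metric.ball_subset_closedBall hx)
    exact (mul_le_mul_of_nonneg_left hcx t.coe_nonneg).trans_lt htc
  have h1 := integral_det_id_add_eq c.2 hint hvol
  have hdet : ∀ x, (ContinuousLinearMap.id ℝ V + fderiv ℝ k x).det = 0 := by
    intro x
    by_contra hne
    have hrd : HasFDerivAt r (ContinuousLinearMap.id ℝ V + fderiv ℝ k x) x := by
      convert (hasFDerivAt_id x).add (hkd x).hasFDerivAt using 1
      ext y
      simp [k]
    have hinner : HasFDerivAt (fun y => inner ℝ (r y) (r y)) (0 : V →L[ℝ] ℝ) x := by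
      simp only [real_inner_self_eq_norm_sq, hr1]
      exact hasFDerivAt_const _ _
    have horth : ∀ v, inner ℝ (r x) ((ContinuousLinearMap.id ℝ V + fderiv ℝ k x) v) = 0 := by
      intro v
      have := congrArg (fun L => L v) ((hrd.inner ℝ hrd).unique hinner)
      simp only [ContinuousLinearMap.comp_apply, fderivInnerCLM_apply,
        ContinuousLinearMap.prod_apply, zero_apply] at this
      rw [real_inner_comm (r x)] at this
      linarith
    obtain ⟨v, hv⟩ := (LinearMap.equivOfDetNeZero _ hne).surjective (r x)
    have := horth v
    rw [show (ContinuousLinearMap.id ℝ V + fderiv ℝ k x) v = r x from hv,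
      real_inner_self_eq_norm_sq, hr1] at this
    norm_num at this
  simp only [hdet, integral_zero] at h1
  exact (ENNReal.toReal_pos (Metric.measure_ball_pos μ 0 one_pos).ne' measure_ball_lt_top.ne).ne h1

/-- A continuous self-map which is the identity outside a ball is surjective. -/
theorem surjective_of_eq_id_outside_ball {f : V → V} (hf : Continuous f) {R : ℝ}
    (hfR : ∀ x, R ≤ ‖x‖ → f x = x) : Function.Surjective f := by
  intro p
  by_contra! hp
  let f' : V → V := fun x => f (x + p) - p
  set R' := R + ‖p‖
  have hf' : Continuous f' := by fun_prop
  have hf'R : ∀ x, R' ≤ ‖x‖ → f' x = x := by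
    intro x hx
    have : ‖x‖ ≤ ‖x + p‖ + ‖p‖ := by simpa using norm_sub_le (x + p) p
    simp [f', hfR (x + p) (by linarith)]
  have hf'0 : ∀ x, 0 < ‖f' x‖ := fun x => norm_pos_iff.2 (sub_ne_zero.2 (hp _))
  have hS : IsClosed {x : V | R' + 1 ≤ ‖x‖} := isClosed_le continuous_const continuous_norm
  have hU : IsOpen {x : V | R' < ‖x‖} := isOpen_lt continuous_const continuous_norm
  obtain ⟨g, hg, hgf, hgS, -⟩ := hf'.exists_contDiff_approx_and_eqOn 1 hf'.norm hf'0 hS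
    (hU.mem_nhdsSet.2 fun x hx => by simp only [mem_ofPred_eq] at hx ⊢; linarith)
    (contDiff_id.contDiffOn.congr fun x hx => hf'R x (le_of_lt hx))
  have hg0 : ∀ x, g x ≠ 0 := by
    intro x h0
    have := hgf x
    simp [h0] at this
  set Q := max 1 (R' + 1)
  have hQ : 0 < Q := one_pos.trans_le (le_max_left _ _)
  refine not_exists_contDiff_retraction (fun x => ‖g (Q • x)‖⁻¹ • g (Q • x)) ?_ ?_ ?_
  · have h1 : ContDiff ℝ 1 fun x => g (Q • x) := hg.comp (contDiff_const_smul Q)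
    exact ((h1.norm ℝ fun x => hg0 _).inv fun x => norm_ne_zero_iff.2 (hg0 _)).smul h1
  · intro x
    rw [norm_smul, norm_inv, norm_norm, inv_mul_cancel₀ (norm_ne_zero_iff.2 (hg0 _))]
  · intro x hx
    have hnorm : ‖Q • x‖ = Q := by rw [norm_smul, hx, mul_one, Real.norm_of_nonneg hQ.le]
    have hgx : g (Q • x) = f' (Q • x) := hgS (by simp [hnorm, Q])
    have : f' (Q • x) = Q • x := hf'R _ (by rw [hnorm]; linarith [le_max_right 1 (R' + 1)])
    simp only [hgx, this, hnorm]
    rw [smul_smul, inv_mul_cancel₀ hQ.ne', one_smul]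

end

section ProperHomotopy

/-- A map properly homotopic to the identity of a finite-dimensional inner product space is
surjective. -/
theorem ProperlyHomotopic.surjective_of_id_right {V : Type*} [NormedAddCommGroup V]
    [InnerProductSpace ℝ V] [FiniteDimensional ℝ V] {f : V → V} (hf : ProperlyHomotopic f id) :
    Function.Surjective f := by
  obtain ⟨H, hH, hH0, hH1⟩ := hf
  intro p
  by_contra! hp
  obtain ⟨R, hR⟩ := ((hH.isCompact_preimage (isCompact_singleton (x := p))).image
    continuous_fst).isBounded.exists_norm_le
  let g : V → V := fun x => H (x, projIcc 0 1 zero_le_one (‖x‖ - (R + 1)))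
  have hg : Continuous g := hH.continuous.comp
    (continuous_id.prodMk (continuous_projIcc.comp (by fun_prop)))
  obtain ⟨x, hx⟩ := surjective_of_eq_id_outside_ball hg (R := R + 2)
    (fun x hx => by
      simp only [g]
      rw [projIcc_of_right_le _ (by linarith)]
      exact hH1 x) p
  have hxR : ‖x‖ ≤ R := hR x ⟨_, hx, rfl⟩
  simp only [g] at hx
  rw [projIcc_of_le_left _ (by linarith)] at hx
  exact hp x ((hH0 x).symm.trans hx)

/-- Proper homotopies can be transported along homeomorphisms of source and target. -/
theorem ProperlyHomotopic.comp_homeomorph {X X' Y Y' : Type*} [TopologicalSpace X]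
    [TopologicalSpace X'] [TopologicalSpace Y] [TopologicalSpace Y'] {f g : X → Y}
    (h : ProperlyHomotopic f g) (e : X' ≃ₜ X) (e' : Y ≃ₜ Y') :
    ProperlyHomotopic (fun x => e' (f (e x))) (fun x => e' (g (e x))) := by
  obtain ⟨H, hH, hH0, hH1⟩ := h
  refine ⟨fun q => e' (H (e q.1, q.2)), ?_, fun x => congrArg e' (hH0 _),
    fun x => congrArg e' (hH1 _)⟩
  exact e'.isProperMap.comp (hH.comp (e.prodCongr (Homeomorph.refl _)).isProperMap)

variable {E : Type*} [NormedAddCommGroup E]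

section Lower

variable [InnerProductSpace ℝ E] [FiniteDimensional ℝ E] [Nontrivial E]

theorem not_properlyHomotopic_diagonal_id (s : E × E → E) :
    ¬ ProperlyHomotopic (fun p => (s p, s p)) (fun p => p) := by
  intro h
  let e := (WithLp.prodContinuousLinearEquiv 2 ℝ E E).toHomeomorph
  have h' := h.comp_homeomorph e e.symm
  simp only [e.symm_apply_apply] at h'
  obtain ⟨a, ha⟩ := exists_ne (0 : E)
  obtain ⟨x, hx⟩ := h'.surjective_of_id_right (e.symm (a, 0))
  have := e.symm.injective hx
  simp only [Prod.mk.injEq] at this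
  exact ha (this.1.symm.trans this.2)

theorem not_pSecatLE_diagonal_zero : ¬ PSecatLE (fun x : E => (x, x)) 0 := by
  rintro ⟨U, -, hU, h⟩
  obtain ⟨s, -, hs⟩ := h 0
  have hU0 : closure (U 0) = univ := by
    have : U 0 = univ := eq_univ_of_univ_subset
      (hU.ge.trans (iUnion_subset fun i => by rw [Fin.fin_one_eq_zero i]))
    rw [this, closure_univ]
  let e : E × E ≃ₜ closure (U 0) :=
    (Homeomorph.Set.univ (E × E)).symm.trans (Homeomorph.setCongr hU0.symm)
  exact not_properlyHomotopic_diagonal_id (fun p => s (e p))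
    (hs.comp_homeomorph e (Homeomorph.refl _))

end Lower

/-- A continuous map between proper metric spaces is proper if the norm of the argument is
controlled by the norm of the value. -/
theorem isProperMap_of_bounded {X Y : Type*} [PseudoMetricSpace X] [ProperSpace X]
    [NormedAddCommGroup Y] [ProperSpace Y] {f : X → Y} (hf : Continuous f)
    (h : ∀ C : ℝ, Bornology.IsBounded {x | ‖f x‖ ≤ C}) : IsProperMap f := by
  refine isProperMap_iff_isCompact_preimage.2 ⟨hf, fun K hK => ?_⟩
  obtain ⟨C, hC⟩ := hK.isBounded.exists_norm_le
  exact Metric.isCompact_of_isClosed_isBounded (hK.isClosed.preimage hf)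
    ((h C).subset fun x hx => hC _ hx)

theorem isProperMap_diagonal [ProperSpace E] : IsProperMap fun x : E => (x, x) := by
  refine isProperMap_of_bounded (by fun_prop) fun C => ?_
  simpa [Prod.norm_def, Metric.closedBall, dist_zero_right] using
    Metric.isBounded_closedBall (x := (0 : E)) (r := C)

variable [InnerProductSpace ℝ E] [FiniteDimensional ℝ E]

/-- Over a closed subset of a half-space of `E × E` the diagonal has a proper homotopy section,
which contracts the half-space onto a diagonal ray. -/
theorem exists_proper_section_diagonal {u : E} (hu : ‖u‖ = 1) {S : Set (E × E)} (hS : IsClosed S)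
    (hSu : ∀ p ∈ S, -1 ≤ inner ℝ u p.1 + inner ℝ u p.2) :
    ∃ s : S → E, IsProperMap s ∧
      ProperlyHomotopic (fun y => (s y, s y)) (fun y : S => (y : E × E)) := by
  have : ProperSpace E := FiniteDimensional.proper ℝ E
  have : ProperSpace S := ⟨fun x r =>
    hS.isClosedEmbedding_subtypeVal.isCompact_preimage (isCompact_closedBall (x : E × E) r)⟩
  have hball : ∀ C : ℝ, Bornology.IsBounded {p : S | ‖(p : E × E)‖ ≤ C} := by
    intro C
    refine (isometry_subtype_coe.antilipschitz.isBounded_preimage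
      (Metric.isBounded_closedBall (x := (0 : E × E)) (r := C))).subset fun p hp => ?_
    simpa using hp
  refine ⟨fun p => ‖(p : E × E)‖ • u, ?_,
    fun q => (1 - (q.2 : ℝ)) • (‖(q.1 : E × E)‖ • u, ‖(q.1 : E × E)‖ • u) +
      (q.2 : ℝ) • (q.1 : E × E),
    ?_, fun x => by simp, fun x => by simp⟩
  · refine isProperMap_of_bounded (by fun_prop) fun C => ?_
    simpa [norm_smul, hu] using hball C
  · refine isProperMap_of_bounded (by fun_prop) fun C => ?_
    refine ((hball (3 * C + 2)).prod (Bornology.IsBounded.all (univ : Set unitInterval))).subset ?_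
    rintro ⟨p, t⟩ hpt
    refine ⟨?_, mem_univ _⟩
    simp only [mem_ofPred_eq] at hpt ⊢
    set N := ‖(p : E × E)‖
    have ht0 : (0 : ℝ) ≤ t := t.2.1
    have ht1 : (t : ℝ) ≤ 1 := t.2.2
    have hN : 0 ≤ N := norm_nonneg _
    have hNu : ‖((N • u, N • u) : E × E)‖ = N := by simp [Prod.norm_def, norm_smul, hu, hN]
    set w := (1 - (t : ℝ)) • ((N • u, N • u) : E × E) + (t : ℝ) • (p : E × E) with hw
    have h1 : t * N ≤ C + (1 - t) * N := by
      have h := norm_sub_le w ((1 - (t : ℝ)) • ((N • u, N • u) : E × E))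
      rw [hw, add_sub_cancel_left, ← hw, norm_smul, norm_smul, hNu, Real.norm_of_nonneg ht0,
        Real.norm_of_nonneg (sub_nonneg.2 ht1)] at h
      linarith
    have hin : ∀ v : E, ‖v‖ ≤ ‖w‖ → inner ℝ u v ≤ C := by
      intro v hv
      refine (real_inner_le_norm u v).trans ?_
      rw [hu, one_mul]
      exact hv.trans hpt
    have h2 := hin w.1 (norm_fst_le w)
    have h3 := hin w.2 (norm_snd_le w)
    simp only [hw, Prod.fst_add, Prod.snd_add, Prod.smul_fst, Prod.smul_snd, inner_add_right,
      inner_smul_right, real_inner_self_eq_norm_sq, hu] at h2 h3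
    have h4 := mul_le_mul_of_nonneg_left (hSu p p.2) ht0
    nlinarith

theorem pSecatLE_diagonal_one [Nontrivial E] : PSecatLE (fun x : E => (x, x)) 1 := by
  obtain ⟨u, hu⟩ := exists_norm_eq E zero_le_one
  let U : E → Set (E × E) := fun u => {p | -1 < inner ℝ u p.1 + inner ℝ u p.2}
  have hU : ∀ u, IsOpen (U u) := fun u => isOpen_lt (by fun_prop) (by fun_prop)
  have hcl : ∀ u, closure (U u) ⊆ {p | -1 ≤ inner ℝ u p.1 + inner ℝ u p.2} := fun u =>
    closure_minimal (fun p hp => mem_ofPred.2 (le_of_lt hp)) (isClosed_le (by fun_prop) (by fun_prop))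
  let v : Fin 2 → E := ![u, -u]
  have hv : ∀ i, ‖v i‖ = 1 := by
    intro i
    fin_cases i <;> simp [v, hu]
  refine ⟨fun i => U (v i), fun i => hU _, eq_univ_of_forall fun p => ?_, fun i =>
    exists_proper_section_diagonal (hv i) isClosed_closure fun p hp => hcl _ hp⟩
  rw [mem_iUnion, Fin.exists_fin_two]
  simp only [U, v, mem_ofPred_eq, Matrix.cons_val_zero, Matrix.cons_val_one, inner_neg_left]
  by_contra! h
  linarith [h.1, h.2]

theorem pSecat_diagonal_eq_one [Nontrivial E] : pSecat (fun x : E => (x, x)) = 1 := by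
  refine le_antisymm (sInf_le ⟨1, Nat.cast_one.symm, pSecatLE_diagonal_one⟩) (le_sInf ?_)
  rintro _ ⟨m, rfl, hm⟩
  rcases Nat.eq_zero_or_pos m with rfl | hpos
  · exact absurd hm not_pSecatLE_diagonal_zero
  · exact_mod_cast hpos

end ProperHomotopy

/-- For every `n ≥ 1`, the diagonal `Δ : ℝⁿ → ℝⁿ × ℝⁿ` is a proper map with
`p-secat Δ = 1`; in particular it admits no proper homotopy section. -/
theorem pSecat_diagonal_euclidean (n : ℕ) (hn : 1 ≤ n) :
    IsProperMap (fun x : EuclideanSpace ℝ (Fin n) => (x, x)) ∧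
    pSecat (fun x : EuclideanSpace ℝ (Fin n) => (x, x)) = 1 ∧
    ¬ ∃ s : EuclideanSpace ℝ (Fin n) × EuclideanSpace ℝ (Fin n) → EuclideanSpace ℝ (Fin n),
        IsProperMap s ∧
        ProperlyHomotopic ((fun x : EuclideanSpace ℝ (Fin n) => (x, x)) ∘ s)
          (id : EuclideanSpace ℝ (Fin n) × EuclideanSpace ℝ (Fin n) →
            EuclideanSpace ℝ (Fin n) × EuclideanSpace ℝ (Fin n)) := by
  have : Nonempty (Fin n) := ⟨⟨0, hn⟩⟩
  have : Nontrivial (EuclideanSpace ℝ (Fin n)) := inferInstance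
  exact ⟨isProperMap_diagonal, pSecat_diagonal_eq_one, fun ⟨s, _, hs⟩ =>
    not_properlyHomotopic_diagonal_id s hs⟩

end
end

section
/- For all integers n ≥ 1 and m ≥ 2, 2 ≤ pTC(Sⁿ × ℝᵐ) ≤ 4, where Sⁿ is the unit sphere in ℝ^{n+1}. -/
open Set unitInterval
open scoped NNReal ENNReal

noncomputable section

universe u v

section Brouwer

open MeasureTheory Metric Polynomial

variable {E : Type*} [NormedAddCommGroup E]

theorem exists_det_one_add_eq_sum [NormedSpace ℝ E] [FiniteDimensional ℝ E] {δ : ℝ} (hδ : 0 < δ) :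
    ∃ (s : Finset ℝ) (c : ℝ → ℝ), (∀ t ∈ s, t ∈ Ioo 0 δ) ∧ ∑ t ∈ s, c t = 1 ∧
      ∀ A : E →L[ℝ] E, (1 + A).det = ∑ t ∈ s, c t * (1 + t • A).det := by
  classical
  obtain ⟨s, hs, hcard⟩ :=
    (Ioo_infinite hδ).exists_subset_card_eq (Module.finrank ℝ E + 1)
  have hinj : Set.InjOn (id : ℝ → ℝ) s := Function.injective_id.injOn
  refine ⟨s, fun t => (Lagrange.basis s id t).eval 1, fun t ht => hs ht, ?_, fun A => ?_⟩
  · have hne : s.Nonempty := Finset.card_pos.1 (by lia)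
    have := congrArg (Polynomial.eval 1) (Lagrange.sum_basis hinj hne)
    simpa [Polynomial.eval_finsetSum] using this
  · let b := Module.finBasis ℝ E
    let M := LinearMap.toMatrix b b (A : E →ₗ[ℝ] E)
    let P : ℝ[X] := Matrix.det ((X : ℝ[X]) • M.map C + (1 : Matrix _ _ ℝ).map C)
    have hP : ∀ t : ℝ, P.eval t = (1 + t • A).det := by
      intro t
      have h1 : (1 + t • A).det = LinearMap.det ((1 + t • A : E →L[ℝ] E) : E →ₗ[ℝ] E) := rfl
      rw [h1, ← LinearMap.det_toMatrix b]
      simp only [P]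
      rw [← Polynomial.coe_evalRingHom, RingHom.map_det]
      congr 1
      ext i j
      simp [M, LinearMap.toMatrix_apply, Matrix.one_apply, apply_ite (Polynomial.eval t),
        Finsupp.single_apply, eq_comm, add_comm, mul_comm t]
    have hdeg : P.degree < s.card := by
      rw [hcard]
      refine lt_of_le_of_lt Polynomial.degree_le_natDegree ?_
      have := Polynomial.natDegree_det_X_add_C_le M (1 : Matrix _ _ ℝ)
      simp only [Fintype.card_fin] at this
      exact_mod_cast Nat.lt_succ_of_le this
    have h := Lagrange.eq_interpolate hinj hdeg
    have h1 := hP 1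
    rw [one_smul] at h1
    rw [← h1, h, Lagrange.interpolate_apply, Polynomial.eval_finsetSum]
    refine Finset.sum_congr rfl fun t _ => ?_
    rw [Polynomial.eval_mul, Polynomial.eval_C, id, hP, mul_comm]

theorem det_one_add_pos_of_norm_lt_one [NormedSpace ℝ E] [FiniteDimensional ℝ E]
    {A : E →L[ℝ] E} (hA : ‖A‖ < 1) : 0 < (1 + A).det := by
  have hcont : ContinuousOn (fun t : ℝ => (1 + t • A).det) (Icc 0 1) :=
    (ContinuousLinearMap.continuous_det.comp (by fun_prop)).continuousOn
  have hne : ∀ t ∈ Icc (0 : ℝ) 1, (1 + t • A).det ≠ 0 := by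
    intro t ht
    have h : IsUnit (1 + t • A) := by
      have : ‖-(t • A)‖ < 1 := by
        rw [norm_neg, norm_smul, Real.norm_of_nonneg ht.1]
        nlinarith [ht.1, ht.2, norm_nonneg A]
      simpa using isUnit_one_sub_of_norm_lt_one this
    exact (LinearMap.isUnit_det _ (h.map ContinuousLinearMap.toLinearMapRingHom)).ne_zero
  by_contra! hneg
  obtain ⟨t, ht, h0⟩ := intermediate_value_Icc' zero_le_one hcont
    (show (0 : ℝ) ∈ Icc _ _ by simpa [ContinuousLinearMap.det] using hneg)
  exact hne t ht h0

theorem lipschitzWith_indicator_closedBall_s17 [NormedSpace ℝ E] {F : Type*} [NormedAddCommGroup F]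
    {φ : E → F} {R : ℝ} {L : ℝ≥0} (hφ : LipschitzOnWith L φ (closedBall 0 R))
    (h0 : ∀ x, ‖x‖ = R → φ x = 0) : LipschitzWith L ((closedBall 0 R).indicator φ) := by
  have key : ∀ x y : E, x ∈ closedBall 0 R → y ∉ closedBall 0 R → ‖φ x‖ ≤ L * ‖x - y‖ := by
    intro x y hx hy
    simp only [mem_closedBall, dist_zero_right, not_le] at hx hy
    have hc : ContinuousOn (fun t : ℝ => ‖AffineMap.lineMap x y t‖) (Icc 0 1) := by fun_prop
    obtain ⟨t, ht, hz⟩ := intermediate_value_Icc zero_le_one hc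
      (show R ∈ Icc _ _ by simpa using ⟨hx, hy.le⟩)
    have h := hφ.norm_sub_le (by simpa using hx)
      (show AffineMap.lineMap x y t ∈ closedBall 0 R by simpa using hz.le)
    rw [h0 _ hz, sub_zero] at h
    refine h.trans (mul_le_mul_of_nonneg_left ?_ L.2)
    rw [← dist_eq_norm, ← dist_eq_norm, dist_left_lineMap, Real.norm_of_nonneg ht.1]
    exact mul_le_of_le_one_left dist_nonneg ht.2
  refine LipschitzWith.of_dist_le_mul fun x y => ?_
  rw [dist_eq_norm, dist_eq_norm]
  by_cases hx : x ∈ closedBall 0 R <;> by_cases hy : y ∈ closedBall 0 R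
  · simpa [hx, hy] using hφ.norm_sub_le hx hy
  · simpa [indicator_of_mem hx, indicator_of_notMem hy] using key x y hx hy
  · simpa [indicator_of_mem hy, indicator_of_notMem hx, norm_sub_rev x y] using key y x hy hx
  · simpa [indicator_of_notMem hy, indicator_of_notMem hx] using by positivity

theorem bijective_id_add_of_lipschitzWith_s17 [NormedSpace ℝ E] [CompleteSpace E] {φ : E → E} {L : ℝ≥0}
    (hL : L < 1) (hφ : LipschitzWith L φ) : Function.Bijective fun x => x + φ x := by
  have h : ApproximatesLinearOn (fun x => x + φ x)
      ((ContinuousLinearEquiv.refl ℝ E : E ≃L[ℝ] E) : E →L[ℝ] E) univ L := by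
    rw [ApproximatesLinearOn.approximatesLinearOn_iff_lipschitzOnWith]
    convert hφ.lipschitzOnWith (s := univ) using 1
    ext x; simp
  have hc : Subsingleton E ∨
      L < ‖((ContinuousLinearEquiv.refl ℝ E).symm : E →L[ℝ] E)‖₊⁻¹ := by
    rcases subsingleton_or_nontrivial E with hE | hE
    · exact Or.inl hE
    · right
      simpa using hL
  exact ⟨injOn_univ.1 (h.injOn hc), h.surjective hc⟩

variable [InnerProductSpace ℝ E] [FiniteDimensional ℝ E]

theorem setIntegral_det_one_add_fderiv [MeasurableSpace E] [BorelSpace E]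
    {μ : Measure E} [μ.IsAddHaarMeasure] {φ : E → E}
    {R : ℝ} (hφ : ContDiff ℝ 1 φ) (h0 : ∀ x, ‖x‖ = R → φ x = 0) :
    ∫ x in closedBall 0 R, (1 + fderiv ℝ φ x).det ∂μ = μ.real (closedBall 0 R) := by
  have hcpt : IsCompact (closedBall (0 : E) R) := isCompact_closedBall 0 R
  have hfd : Continuous (fderiv ℝ φ) := hφ.continuous_fderiv (by simp)
  obtain ⟨L, hL⟩ := hcpt.exists_bound_of_continuousOn hfd.continuousOn
  set K : ℝ≥0 := L.toNNReal + 1 with hK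
  have hLK : ∀ x ∈ closedBall (0 : E) R, ‖fderiv ℝ φ x‖₊ ≤ K := by
    intro x hx
    rw [← NNReal.coe_le_coe, coe_nnnorm]
    refine (hL x hx).trans ?_
    rw [hK]; push_cast
    linarith [Real.le_coe_toNNReal L]
  have hlip : LipschitzOnWith K φ (closedBall 0 R) :=
    (convex_closedBall 0 R).lipschitzOnWith_of_nnnorm_fderiv_le
      (fun x _ => (hφ.differentiable (by simp)).differentiableAt) hLK
  have hind := lipschitzWith_indicator_closedBall_s17 hlip h0
  have hK0 : (0 : ℝ) < K := by rw [hK]; positivity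
  have hdetc : ∀ t : ℝ, Continuous fun x => (1 + t • fderiv ℝ φ x).det := fun t =>
    ContinuousLinearMap.continuous_det.comp (by fun_prop)
  have hsmall : ∀ t ∈ Ioo (0 : ℝ) (K : ℝ)⁻¹,
      ∫ x in closedBall 0 R, (1 + t • fderiv ℝ φ x).det ∂μ = μ.real (closedBall 0 R) := by
    intro t ht
    have htK : t * K < 1 := by
      have := mul_lt_mul_of_pos_right ht.2 hK0
      rwa [inv_mul_cancel₀ hK0.ne'] at this
    have hbij : Function.Bijective fun x => x + t • (closedBall 0 R).indicator φ x := by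
      refine bijective_id_add_of_lipschitzWith_s17 (L := ‖t‖₊ * K) ?_ ?_
      · rw [← NNReal.coe_lt_coe]
        simpa [abs_of_pos ht.1] using htK
      · exact (lipschitzWith_smul t).comp hind
    have himage : (fun x => x + t • φ x) '' closedBall 0 R = closedBall 0 R := by
      have hout : ∀ x ∉ closedBall (0 : E) R, x + t • (closedBall 0 R).indicator φ x = x := by
        intro x hx; simp [indicator_of_notMem hx]
      have hin : ∀ x ∈ closedBall (0 : E) R,
          x + t • (closedBall 0 R).indicator φ x = x + t • φ x := by
        intro x hx; simp [indicator_of_mem hx]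
      rw [← image_congr hin]
      ext y
      constructor
      · rintro ⟨x, hx, rfl⟩
        by_contra hy
        exact hy ((congrArg (· ∈ closedBall (0 : E) R) (hbij.1 (hout _ hy))).mpr hx)
      · intro hy
        obtain ⟨x, rfl⟩ := hbij.2 y
        refine ⟨x, ?_, rfl⟩
        by_contra hx
        exact hx ((congrArg (· ∈ closedBall (0 : E) R) (hout x hx)).mp hy)
    have hinj : InjOn (fun x => x + t • φ x) (closedBall 0 R) := by
      intro x hx y hy hxy
      refine hbij.1 ?_
      simpa [indicator_of_mem hx, indicator_of_mem hy] using hxy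
    have hderiv : ∀ x ∈ closedBall (0 : E) R, HasFDerivWithinAt (fun x => x + t • φ x)
        (1 + t • fderiv ℝ φ x) (closedBall 0 R) x := by
      intro x _
      exact ((hasFDerivAt_id x).add
        ((hφ.differentiable (by simp) x).hasFDerivAt.const_smul t)).hasFDerivWithinAt
    have hpos : ∀ x ∈ closedBall (0 : E) R, 0 ≤ (1 + t • fderiv ℝ φ x).det := by
      intro x hx
      refine (det_one_add_pos_of_norm_lt_one ?_).le
      rw [norm_smul, Real.norm_of_nonneg ht.1.le]
      exact (mul_le_mul_of_nonneg_left (NNReal.coe_le_coe.2 (hLK x hx)) ht.1.le).trans_lt htK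
    have hvol := lintegral_abs_det_fderiv_eq_addHaar_image μ measurableSet_closedBall hderiv hinj
    rw [himage] at hvol
    rw [Measure.real, ← hvol, integral_eq_lintegral_of_nonneg_ae]
    · congr 1
      refine setLIntegral_congr_fun measurableSet_closedBall fun x hx => ?_
      simp only [abs_of_nonneg (hpos x hx)]
    · exact (ae_restrict_iff' measurableSet_closedBall).2 (Filter.Eventually.of_forall hpos)
    · exact (hdetc t).aestronglyMeasurable
  obtain ⟨s, c, hs, hc, hdet⟩ := exists_det_one_add_eq_sum (E := E) (inv_pos.2 hK0)
  simp only [fun x => hdet (fderiv ℝ φ x)]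
  rw [integral_finsetSum]
  · simp_rw [integral_const_mul]
    rw [Finset.sum_congr rfl fun t ht => by rw [hsmall t (hs t ht)], ← Finset.sum_mul, hc, one_mul]
  · intro t _
    exact (((hdetc t).continuousOn).integrableOn_compact hcpt).const_mul _

theorem exists_eq_zero_of_eq_id_off_ball {f : E → E} (hf : Continuous f) {R : ℝ} (hR : 0 < R)
    (hid : ∀ x, R ≤ ‖x‖ → f x = x) : ∃ x, f x = 0 := by
  by_contra! hne
  obtain ⟨g, hg, hgf, hsupp⟩ := (hf.sub continuous_id).exists_contDiff_approx 1
    (ε := fun x => ‖f x‖ / 2) (by fun_prop) (fun x => by have := norm_pos_iff.2 (hne x); positivity)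
  let h : E → E := fun x => x + g x
  have hh : ContDiff ℝ 1 h := contDiff_id.add hg
  have hh0 : ∀ x, h x ≠ 0 := by
    intro x hx
    have h1 := hgf x
    have h2 : g x = -x := eq_neg_of_add_eq_zero_right hx
    have := norm_pos_iff.2 (hne x)
    simp only [h2, dist_eq_norm, Pi.sub_apply, id, neg_sub_left, sub_add_cancel, norm_neg] at h1
    linarith
  have hhid : ∀ x, R ≤ ‖x‖ → h x = x := by
    intro x hx
    have : g x = 0 := by
      by_contra hgx
      exact hsupp hgx (by simp [hid x hx])
    simp [h, this]
  let ρ : E → E := fun x => (R * ‖h x‖⁻¹) • h x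
  have hρ : ContDiff ℝ 1 ρ :=
    (contDiff_const.mul ((hh.norm ℝ hh0).inv fun x => (norm_pos_iff.2 (hh0 x)).ne')).smul hh
  have hρn : ∀ x, inner ℝ (ρ x) (ρ x) = R ^ 2 := by
    intro x
    have := norm_pos_iff.2 (hh0 x)
    rw [real_inner_self_eq_norm_sq, norm_smul, norm_mul, norm_inv, norm_norm,
      mul_assoc, inv_mul_cancel₀ this.ne', mul_one, Real.norm_eq_abs, sq_abs]
  have hρd : Differentiable ℝ ρ := hρ.differentiable (by simp)
  have hdet : ∀ x, (1 + fderiv ℝ (fun x => ρ x - x) x).det = 0 := by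
    intro x
    have h1 : 1 + fderiv ℝ (fun x => ρ x - x) x = fderiv ℝ ρ x := by
      rw [fderiv_fun_sub (hρd x) differentiableAt_fun_id, fderiv_fun_id]
      simp [ContinuousLinearMap.one_def]
    rw [h1]
    by_contra hd
    have hsurj : Function.Surjective (fderiv ℝ ρ x : E →ₗ[ℝ] E) :=
      (LinearMap.equivOfDetNeZero _ hd).surjective
    obtain ⟨v, hv⟩ := hsurj (ρ x)
    have h2 : fderiv ℝ (fun y => inner ℝ (ρ y) (ρ y)) x v = 0 := by
      simp only [hρn, fderiv_fun_const, Pi.zero_apply, zero_apply]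
    rw [fderiv_inner_apply ℝ (hρd x) (hρd x)] at h2
    have hv' : fderiv ℝ ρ x v = ρ x := hv
    rw [hv', hρn] at h2
    nlinarith
  let : MeasurableSpace E := borel E
  have : BorelSpace E := ⟨rfl⟩
  have hint := setIntegral_det_one_add_fderiv (μ := Measure.addHaar) (φ := fun x => ρ x - x)
    (R := R) (hρ.sub contDiff_id) (by
      intro x hx
      have hx0 : ‖x‖ ≠ 0 := by rw [hx]; exact hR.ne'
      simp [ρ, hhid x hx.ge, hx, hR.ne'])
  simp only [hdet, integral_zero] at hint
  exact (measureReal_ne_zero_iff measure_closedBall_lt_top.ne).2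
    (measure_closedBall_pos _ _ hR).ne' hint.symm

end Brouwer

section Sphere

open Metric Filter Topology

theorem surjective_of_eq_id_off_bounded {E : Type*} [NormedAddCommGroup E] [NormedSpace ℝ E]
    [FiniteDimensional ℝ E] {f : E → E} (hf : Continuous f) {s : Set E}
    (hs : Bornology.IsBounded s) (hid : ∀ x ∉ s, f x = x) : Function.Surjective f := by
  intro y
  let e := toEuclidean (E := E)
  have hb : Bornology.IsBounded ((fun x => e x - e y) '' s) :=
    ((hs.isCompact_closure.image (f := fun x => e x - e y) (by fun_prop)).isBounded).subset
      (image_mono subset_closure)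
  obtain ⟨R, hR, hsub⟩ := hb.subset_ball_lt 0 0
  obtain ⟨z, hz⟩ := exists_eq_zero_of_eq_id_off_ball
    (f := fun z => e (f (e.symm (z + e y))) - e y) (by fun_prop) hR (by
      intro z hz
      have : e.symm (z + e y) ∉ s := fun hmem => by
        have := hsub ⟨_, hmem, rfl⟩
        simp at this
        linarith
      rw [hid _ this, e.apply_symm_apply, add_sub_cancel_right])
  exact ⟨e.symm (z + e y), e.injective (sub_eq_zero.1 hz)⟩

theorem exists_mem_eq_of_homotopy {E : Type*} [NormedAddCommGroup E] [NormedSpace ℝ E]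
    [FiniteDimensional ℝ E] {Ω : Set E} (hΩ : IsOpen Ω) (hb : Bornology.IsBounded Ω)
    {H : E × I → E} (hH : ContinuousOn H (closure Ω ×ˢ univ))
    (h0 : ∀ x ∈ closure Ω, H (x, 0) = x) {y : E} (hy : y ∈ Ω)
    (hfr : ∀ x ∈ frontier Ω, ∀ t, H (x, t) ≠ y) : ∃ x ∈ Ω, H (x, 1) = y := by
  classical
  have hcpt : IsCompact (closure Ω ×ˢ (univ : Set I)) := hb.isCompact_closure.prod isCompact_univ
  have hA : IsCompact (Prod.fst '' ((closure Ω ×ˢ (univ : Set I)) ∩ H ⁻¹' {y})) :=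
    (hcpt.of_isClosed_subset (hH.preimage_isClosed_of_isClosed hcpt.isClosed isClosed_singleton)
      inter_subset_left).image continuous_fst
  set A := Prod.fst '' ((closure Ω ×ˢ (univ : Set I)) ∩ H ⁻¹' {y}) with hAdef
  have hdisj : Disjoint Ωᶜ A := by
    rw [disjoint_left]
    rintro _ hx ⟨⟨x, t⟩, ⟨⟨hxc, -⟩, hxy⟩, rfl⟩
    exact hfr x ⟨hxc, by rwa [hΩ.interior_eq]⟩ t hxy
  obtain ⟨χ, hχ0, hχ1, hχI⟩ :=
    exists_continuous_zero_one_of_isClosed hΩ.isClosed_compl hA.isClosed hdisj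
  let c : E → I := fun x => ⟨χ x, hχI x⟩
  have hc : Continuous c := χ.continuous.subtype_mk _
  let Ψ : E → E := Ω.piecewise (fun x => H (x, c x)) id
  have hΨ : Continuous Ψ := by
    refine continuous_piecewise ?_ ?_ continuousOn_id
    · intro x hx
      have hx' : x ∈ Ωᶜ := fun h => hx.2 (by rwa [hΩ.interior_eq])
      have : c x = 0 := Subtype.ext (hχ0 hx')
      rw [this, h0 x hx.1, id]
    · exact hH.comp (by fun_prop) fun x hx => ⟨hx, mem_univ _⟩
  obtain ⟨x, hx⟩ := surjective_of_eq_id_off_bounded hΨ hb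
    (fun x hx => piecewise_eq_of_notMem _ _ _ hx) y
  have hxΩ : x ∈ Ω := by
    by_contra h
    rw [show Ψ x = x from piecewise_eq_of_notMem _ _ _ h] at hx
    exact h (hx ▸ hy)
  rw [show Ψ x = H (x, c x) from piecewise_eq_of_mem _ _ _ hxΩ] at hx
  have hxA : x ∈ A := ⟨(x, c x), ⟨⟨subset_closure hxΩ, mem_univ _⟩, hx⟩, rfl⟩
  have : c x = 1 := Subtype.ext (hχ1 hxA)
  exact ⟨x, hxΩ, this ▸ hx⟩

variable {V W : Type*} [NormedAddCommGroup V] [InnerProductSpace ℝ V]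
  [NormedAddCommGroup W] [InnerProductSpace ℝ W]

open Classical in
/-- The radial projection of a normed space to its unit sphere, with a default value at `0`. -/
def radialProj (a : sphere (0 : V) 1) (x : V) : sphere (0 : V) 1 :=
  if h : x ≠ 0 then
    ⟨‖x‖⁻¹ • x, by simp [norm_smul, inv_mul_cancel₀ (norm_ne_zero_iff.2 h)]⟩ else a

theorem coe_radialProj (a : sphere (0 : V) 1) {x : V} (hx : x ≠ 0) :
    (radialProj a x : V) = ‖x‖⁻¹ • x := by
  rw [radialProj, dif_pos hx]

theorem radialProj_smul (a b : sphere (0 : V) 1) {r : ℝ} (hr : 0 < r) :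
    radialProj a (r • (b : V)) = b := by
  have hb : ‖(b : V)‖ = 1 := norm_eq_of_mem_sphere b
  have hb0 : (b : V) ≠ 0 := norm_ne_zero_iff.1 (by rw [hb]; exact one_ne_zero)
  refine Subtype.ext ?_
  rw [coe_radialProj a (smul_ne_zero hr.ne' hb0), norm_smul, hb, Real.norm_of_nonneg hr.le,
    mul_one, smul_smul, inv_mul_cancel₀ hr.ne', one_smul]

theorem radialProj_coe (a b : sphere (0 : V) 1) : radialProj a (b : V) = b := by
  simpa using radialProj_smul a b one_pos

theorem norm_smul_radialProj (a : sphere (0 : V) 1) {x : V} (hx : x ≠ 0) :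
    ‖x‖ • (radialProj a x : V) = x := by
  rw [coe_radialProj a hx, smul_smul, mul_inv_cancel₀ (norm_ne_zero_iff.2 hx), one_smul]

theorem continuousAt_radialProj (a : sphere (0 : V) 1) {x : V} (hx : x ≠ 0) :
    ContinuousAt (radialProj a) x := by
  refine Topology.IsInducing.subtypeVal.continuousAt_iff.2 ?_
  have h : ContinuousAt (fun x : V => ‖x‖⁻¹ • x) x :=
    (continuousAt_id.norm.inv₀ (norm_ne_zero_iff.2 hx)).smul continuousAt_id
  refine h.congr ?_
  filter_upwards [isOpen_ne.mem_nhds hx] with z hz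
  exact (coe_radialProj a hz).symm

theorem surjective_of_homotopy_sphere_prod [FiniteDimensional ℝ V] [FiniteDimensional ℝ W]
    {F : (sphere (0 : V) 1 × sphere (0 : W) 1) × I → sphere (0 : V) 1 × sphere (0 : W) 1}
    (hF : Continuous F) (h0 : ∀ a, F (a, 0) = a) : Function.Surjective fun a => F (a, 1) := by
  intro b
  let Ω : Set (V × W) := {x | (1 / 2 < ‖x.1‖ ∧ ‖x.1‖ < 2) ∧ 1 / 2 < ‖x.2‖ ∧ ‖x.2‖ < 2}
  have hΩ : IsOpen Ω := by
    refine (IsOpen.and ?_ ?_).and (IsOpen.and ?_ ?_) <;>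
      exact isOpen_lt (by fun_prop) (by fun_prop)
  have hb : Bornology.IsBounded Ω := by
    refine isBounded_ball.subset (fun x hx => ?_ : Ω ⊆ ball 0 2)
    simpa [Prod.norm_def] using ⟨hx.1.2, hx.2.2⟩
  have hcl : ∀ x ∈ closure Ω, 1 / 2 ≤ ‖x.1‖ ∧ 1 / 2 ≤ ‖x.2‖ := by
    let C : Set (V × W) := {x | 1 / 2 ≤ ‖x.1‖ ∧ 1 / 2 ≤ ‖x.2‖}
    have hc : IsClosed C :=
      (isClosed_le (by fun_prop) (by fun_prop)).and (isClosed_le (by fun_prop) (by fun_prop))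
    have hsub : Ω ⊆ C := fun y hy => ⟨hy.1.1.le, hy.2.1.le⟩
    exact fun x hx => closure_minimal hsub hc hx
  have hne : ∀ x ∈ closure Ω, x.1 ≠ 0 ∧ x.2 ≠ 0 := fun x hx =>
    ⟨norm_ne_zero_iff.1 (by linarith [(hcl x hx).1]),
      norm_ne_zero_iff.1 (by linarith [(hcl x hx).2])⟩
  let G : (V × W) × I → sphere (0 : V) 1 × sphere (0 : W) 1 :=
    fun p => F ((radialProj b.1 p.1.1, radialProj b.2 p.1.2), p.2)
  have hG : ContinuousOn G (closure Ω ×ˢ univ) := by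
    intro p hp
    refine ContinuousAt.continuousWithinAt (hF.continuousAt.comp ?_)
    have h1 : ContinuousAt (fun p : (V × W) × I => radialProj b.1 p.1.1) p :=
      (continuousAt_radialProj b.1 (hne _ hp.1).1).comp (f := fun p : (V × W) × I => p.1.1)
        (by fun_prop)
    have h2 : ContinuousAt (fun p : (V × W) × I => radialProj b.2 p.1.2) p :=
      (continuousAt_radialProj b.2 (hne _ hp.1).2).comp (f := fun p : (V × W) × I => p.1.2)
        (by fun_prop)
    exact (h1.prodMk h2).prodMk continuousAt_snd
  let H : (V × W) × I → V × W := fun p => (‖p.1.1‖ • ((G p).1 : V), ‖p.1.2‖ • ((G p).2 : W))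
  have hH : ContinuousOn H (closure Ω ×ˢ univ) :=
    (ContinuousOn.smul (by fun_prop) (by fun_prop)).prodMk
      (ContinuousOn.smul (by fun_prop) (by fun_prop))
  have hn1 : ∀ c : sphere (0 : V) 1, ‖(c : V)‖ = 1 := norm_eq_of_mem_sphere
  have hn2 : ∀ c : sphere (0 : W) 1, ‖(c : W)‖ = 1 := norm_eq_of_mem_sphere
  have hnorm : ∀ x t, H (x, t) = ((b.1 : V), (b.2 : W)) → ‖x.1‖ = 1 ∧ ‖x.2‖ = 1 := by
    intro x t h
    have h1 := congrArg (fun z => ‖z.1‖) h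
    have h2 := congrArg (fun z => ‖z.2‖) h
    simpa [H, norm_smul, hn1, hn2] using And.intro h1 h2
  obtain ⟨x, hx, hxb⟩ := exists_mem_eq_of_homotopy hΩ hb hH
    (fun x hx => by
      simp only [H, G, h0]
      rw [norm_smul_radialProj _ (hne x hx).1, norm_smul_radialProj _ (hne x hx).2])
    (y := ((b.1 : V), (b.2 : W))) (by simp only [Ω, mem_ofPred_eq, hn1, hn2]; norm_num)
    (fun x hx t h => by
      obtain ⟨h1, h2⟩ := hnorm x t h
      refine hx.2 ?_
      rw [hΩ.interior_eq]
      simp only [Ω, mem_ofPred_eq, h1, h2]; norm_num)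
  obtain ⟨h1, h2⟩ := hnorm x 1 hxb
  refine ⟨(radialProj b.1 x.1, radialProj b.2 x.2), ?_⟩
  simp only [H, G, h1, h2, one_smul, Prod.mk.injEq] at hxb
  exact Prod.ext (Subtype.ext hxb.1) (Subtype.ext hxb.2)

open Classical in
theorem continuous_truncate_homotopy {X Y : Type*} [TopologicalSpace X] [TopologicalSpace Y]
    {U : Set X} (hU : IsOpen U) {h : U × I → Y} (hh : Continuous h) {f : X → Y}
    (hf : Continuous f) (h0 : ∀ x : U, h (x, 0) = f x) {c : X → I} (hc : Continuous c)
    (hcU : ∀ x ∉ U, ∀ᶠ y in 𝓝 x, c y = 0) :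
    Continuous fun p : X × I => if hx : p.1 ∈ U then h (⟨p.1, hx⟩, p.2 * c p.1) else f p.1 := by
  rw [continuous_iff_continuousAt]
  rintro ⟨x, t⟩
  by_cases hx : x ∈ U
  · have hemb : IsOpenEmbedding (Prod.map Subtype.val id : U × I → X × I) :=
      hU.isOpenEmbedding_subtypeVal.prodMap .id
    refine (hemb.continuousAt_iff (x := (⟨x, hx⟩, t))).1 ?_
    have : Continuous fun p : U × I => h (p.1, p.2 * c p.1) := by fun_prop
    convert! this.continuousAt using 1
    ext p
    simp
  · refine (hf.comp continuous_fst).continuousAt.congr ?_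
    have := (continuous_fst (X := X) (Y := I)).continuousAt (x := (x, t)) |>.eventually (hcU x hx)
    filter_upwards [this] with p hp
    by_cases hpU : p.1 ∈ U
    · simp [hpU, hp, h0]
    · simp [hpU]

theorem not_sphere_prod_cover [FiniteDimensional ℝ V] [FiniteDimensional ℝ W]
    (a : sphere (0 : V) 1 × sphere (0 : W) 1)
    {U U' : Set (sphere (0 : V) 1 × sphere (0 : W) 1)} (hU : IsOpen U) (hU' : IsOpen U')
    (hcov : U ∪ U' = univ)
    {h : U × I → sphere (0 : V) 1 × sphere (0 : W) 1} (hh : Continuous h)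
    (h0 : ∀ x : U, h (x, 0) = x) (h1 : ∀ x, h (x, 1) = a)
    {h' : U' × I → sphere (0 : V) 1 × sphere (0 : W) 1} (hh' : Continuous h')
    (h0' : ∀ x : U', h' (x, 0) = x) (h1' : ∀ x, h' (x, 1) = a) : False := by
  classical
  have hdisj : Disjoint Uᶜ U'ᶜ := by
    rw [disjoint_iff_inter_eq_empty, ← compl_union, hcov, compl_univ]
  obtain ⟨χ, hχ0, hχ1, -⟩ :=
    exists_continuous_zero_one_of_isClosed hU.isClosed_compl hU'.isClosed_compl hdisj
  let c : sphere (0 : V) 1 × sphere (0 : W) 1 → I :=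
    fun x => projIcc 0 1 zero_le_one (4 * χ x - 1)
  let c' : sphere (0 : V) 1 × sphere (0 : W) 1 → I :=
    fun x => projIcc 0 1 zero_le_one (3 - 4 * χ x)
  have hF := continuous_truncate_homotopy hU (continuous_fst.comp hh) continuous_fst
    (fun x => congrArg Prod.fst (h0 x)) (c := c) (continuous_projIcc.comp (by fun_prop)) (by
      intro x hx
      have hx0 : χ x = 0 := hχ0 hx
      have : ∀ᶠ y in 𝓝 x, χ y < 1 / 4 :=
        χ.continuous.continuousAt.eventually_lt continuousAt_const (by rw [hx0]; norm_num)
      filter_upwards [this] with y hy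
      exact projIcc_of_le_left _ (by linarith))
  have hF' := continuous_truncate_homotopy hU' (continuous_snd.comp hh') continuous_snd
    (fun x => congrArg Prod.snd (h0' x)) (c := c') (continuous_projIcc.comp (by fun_prop)) (by
      intro x hx
      have hx1 : χ x = 1 := hχ1 hx
      have : ∀ᶠ y in 𝓝 x, 3 / 4 < χ y :=
        continuousAt_const.eventually_lt χ.continuous.continuousAt (by rw [hx1]; norm_num)
      filter_upwards [this] with y hy
      exact projIcc_of_le_left _ (by linarith))
  obtain ⟨x, hx⟩ := surjective_of_homotopy_sphere_prod (hF.prodMk hF') (by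
    intro x
    refine Prod.ext ?_ ?_
    · by_cases hx : x ∈ U <;> simp [hx, h0]
    · by_cases hx : x ∈ U' <;> simp [hx, h0']) (-a.1, -a.2)
  rcases le_total (1 / 2) (χ x) with hχ | hχ
  · have hxU : x ∈ U := by
      by_contra hxU
      have : χ x = 0 := hχ0 hxU
      linarith
    have hc : c x = 1 := projIcc_of_right_le _ (by linarith)
    have h2 := congrArg Prod.fst hx
    simp only [hxU, hc, dif_pos, Function.comp_apply, one_mul, h1] at h2
    exact ne_neg_of_mem_unit_sphere ℝ a.1 h2
  · have hxU : x ∈ U' := by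
      by_contra hxU
      have : χ x = 1 := hχ1 hxU
      linarith
    have hc : c' x = 1 := projIcc_of_right_le _ (by linarith)
    have h2 := congrArg Prod.snd hx
    simp only [hxU, hc, dif_pos, Function.comp_apply, one_mul, h1'] at h2
    exact ne_neg_of_mem_unit_sphere ℝ a.2 h2

end Sphere

section LowerBound

open Metric

variable {V W : Type*} [NormedAddCommGroup V] [InnerProductSpace ℝ V] [FiniteDimensional ℝ V]
  [NormedAddCommGroup W] [InnerProductSpace ℝ W] [FiniteDimensional ℝ W]

theorem not_PTCLE_of_le_one (a : sphere (0 : V) 1 × sphere (0 : W) 1) {k : ℕ} (hk : k ≤ 1) :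
    ¬ PTCLE (sphere (0 : V) 1 × W) k := by
  rintro ⟨U, hU, hcov, s, hs, hends, hprop⟩
  obtain ⟨L, hL, -, hLK⟩ := hprop (univ ×ˢ {0}) (isCompact_univ.prod isCompact_singleton)
  obtain ⟨R, hR, hLR⟩ := (hL.image continuous_snd).isBounded.subset_ball_lt 0 0
  have hnorm : ∀ b : sphere (0 : W) 1, ‖R • (b : W)‖ = R := fun b => by
    rw [norm_smul, norm_eq_of_mem_sphere, mul_one, Real.norm_of_nonneg hR.le]
  let y : sphere (0 : V) 1 × sphere (0 : W) 1 → sphere (0 : V) 1 × W :=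
    fun b => (b.1, R • (b.2 : W))
  have hy : Continuous y := by fun_prop
  have hyL : ∀ b, y b ∉ L := fun b hb => by
    have := hLR ⟨_, hb, rfl⟩
    rw [mem_ball_zero_iff, hnorm] at this
    exact lt_irrefl _ this
  let q : sphere (0 : V) 1 × sphere (0 : W) 1 →
    (sphere (0 : V) 1 × W) × (sphere (0 : V) 1 × W) := fun b => (y a, y b)
  have hq : Continuous q := by fun_prop
  let path : ∀ i, (q ⁻¹' U i) × I → sphere (0 : V) 1 × W :=
    fun i p => s i ⟨q p.1, p.1.2⟩ (unitInterval.symm p.2)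
  have hpath : ∀ i, Continuous (path i) := fun i => by
    have h1 : Continuous fun p : (q ⁻¹' U i) × I => s i ⟨q p.1, p.1.2⟩ :=
      (hs i).comp ((hq.comp (by fun_prop)).subtype_mk _)
    exact continuous_eval.comp (h1.prodMk (by fun_prop))
  have hpath0 : ∀ i p, (path i p).2 ≠ 0 := fun i p h0 =>
    hLK i ⟨q p.1, p.1.2⟩ (hyL _) (hyL _) (unitInterval.symm p.2) ⟨mem_univ _, h0⟩
  let h : ∀ i, (q ⁻¹' U i) × I → sphere (0 : V) 1 × sphere (0 : W) 1 :=
    fun i p => ((path i p).1, radialProj a.2 (path i p).2)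
  have hh : ∀ i, Continuous (h i) := fun i => by
    refine (continuous_fst.comp (hpath i)).prodMk (continuous_iff_continuousAt.2 fun p => ?_)
    exact (continuousAt_radialProj a.2 (hpath0 i p)).comp
      (f := fun p => (path i p).2) (continuous_snd.comp (hpath i)).continuousAt
  have h0 : ∀ i x, h i (x, 0) = x := fun i x => by
    have : path i (x, 0) = y x := by
      simpa [path] using (hends i ⟨q x, x.2⟩).2
    simp only [h, this]
    exact Prod.ext rfl (radialProj_smul _ _ hR)
  have h1 : ∀ i x, h i (x, 1) = a := fun i x => by
    have : path i (x, 1) = y a := by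
      simpa [path] using (hends i ⟨q x, x.2⟩).1
    simp only [h, this]
    exact Prod.ext rfl (radialProj_smul _ _ hR)
  refine not_sphere_prod_cover a ((hU 0).preimage hq) ((hU (Fin.last k)).preimage hq) ?_
    (hh 0) (h0 0) (h1 0) (hh _) (h0 _) (h1 _)
  refine eq_univ_of_forall fun x => ?_
  obtain ⟨i, hi⟩ := mem_iUnion.1 (hcov.symm ▸ mem_univ (q x) : q x ∈ ⋃ i, U i)
  have : i = 0 ∨ i = Fin.last k := by
    simp only [Fin.ext_iff, Fin.val_zero, Fin.val_last]
    lia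
  rcases this with rfl | rfl
  · exact Or.inl hi
  · exact Or.inr hi

end LowerBound

section UpperBound

open Metric Filter Topology

variable {V W : Type*} [NormedAddCommGroup V] [InnerProductSpace ℝ V]
  [NormedAddCommGroup W] [InnerProductSpace ℝ W]

/-- Positive exactly when `x` and `y` are nonzero and the cosine of their angle exceeds `-9/10`. -/
def cosGap (x y : V) : ℝ := inner ℝ x y + 9 / 10 * (‖x‖ * ‖y‖)

theorem cosGap_comm (x y : V) : cosGap x y = cosGap y x := by
  simp only [cosGap, real_inner_comm, mul_comm ‖x‖]

theorem cosGap_smul_right (x y : V) {r : ℝ} (hr : 0 ≤ r) :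
    cosGap x (r • y) = r * cosGap x y := by
  simp only [cosGap, inner_smul_right, norm_smul, Real.norm_of_nonneg hr]
  ring

theorem cosGap_smul_left (x y : V) {r : ℝ} (hr : 0 ≤ r) :
    cosGap (r • x) y = r * cosGap x y := by
  rw [cosGap_comm, cosGap_smul_right y x hr, cosGap_comm]

@[fun_prop]
theorem Continuous.cosGap {X : Type*} [TopologicalSpace X] {f g : X → V} (hf : Continuous f)
    (hg : Continuous g) : Continuous fun x => cosGap (f x) (g x) := by
  unfold _root_.cosGap
  fun_prop

theorem norm_add_le_of_cosGap_nonpos {x y : V} (hx : ‖x‖ = 1) (hy : ‖y‖ = 1)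
    (h : cosGap x y ≤ 0) : ‖x + y‖ ≤ 9 / 20 := by
  have h1 := norm_add_sq_real x y
  simp only [cosGap, hx, hy] at h h1
  nlinarith [norm_nonneg (x + y)]

theorem sq_le_norm_segment_sq {x y : V} (hxy : 0 ≤ cosGap x y) {r t : ℝ} (hr : 0 ≤ r)
    (hx : r ≤ ‖x‖) (hy : r ≤ ‖y‖) (ht0 : 0 ≤ t) (ht1 : t ≤ 1) :
    r ^ 2 ≤ 20 * ‖(1 - t) • x + t • y‖ ^ 2 := by
  have h1t : 0 ≤ 1 - t := sub_nonneg.2 ht1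
  rw [norm_add_sq_real, norm_smul, norm_smul, Real.norm_of_nonneg ht0, Real.norm_of_nonneg h1t,
    inner_smul_left, inner_smul_right]
  simp only [conj_trivial]
  have h2 : 0 ≤ ((1 - t) * t) * cosGap x y := by positivity
  have h3 : r ≤ (1 - t) * ‖x‖ + t * ‖y‖ := by nlinarith
  have h4 : r ^ 2 ≤ ((1 - t) * ‖x‖ + t * ‖y‖) ^ 2 := pow_le_pow_left₀ hr h3 2
  simp only [cosGap] at h2
  nlinarith [sq_nonneg ((1 - t) * ‖x‖ - t * ‖y‖)]

/-- The broken line from `x` to `y` through the multiple of `e` by `‖x‖`. -/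
def brokenLine (e x y : V) (t : ℝ) : V :=
  max (1 - 2 * t) 0 • x + (‖x‖ * (1 - |2 * t - 1|)) • e + max (2 * t - 1) 0 • y

theorem sq_le_norm_brokenLine_sq {e x y : V} (he : ‖e‖ = 1) (hxe : 0 ≤ cosGap x e)
    (hye : 0 ≤ cosGap y e) {r t : ℝ} (hr : 0 ≤ r) (hx : r ≤ ‖x‖) (hy : r ≤ ‖y‖)
    (ht0 : 0 ≤ t) (ht1 : t ≤ 1) : r ^ 2 ≤ 20 * ‖brokenLine e x y t‖ ^ 2 := by
  have hw : r ≤ ‖‖x‖ • e‖ := by simpa [norm_smul, he] using hx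
  rcases le_total t (1 / 2) with ht | ht
  · have h : brokenLine e x y t = (1 - 2 * t) • x + (2 * t) • (‖x‖ • e) := by
      rw [brokenLine, max_eq_left (by linarith), max_eq_right (by linarith),
        abs_of_nonpos (by linarith), smul_smul, zero_smul, add_zero]
      congr 2
      ring
    rw [h]
    refine sq_le_norm_segment_sq ?_ hr hx hw (by linarith) (by linarith)
    rw [cosGap_smul_right _ _ (norm_nonneg x)]
    positivity
  · have h : brokenLine e x y t = (1 - (2 * t - 1)) • (‖x‖ • e) + (2 * t - 1) • y := by
      rw [brokenLine, max_eq_right (by linarith), max_eq_left (by linarith),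
        abs_of_nonneg (by linarith), smul_smul, zero_smul, zero_add, mul_comm]
    rw [h]
    refine sq_le_norm_segment_sq ?_ hr hw hy (by linarith) (by linarith)
    rw [cosGap_smul_left _ _ (norm_nonneg x), cosGap_comm]
    positivity

/-- The weights of three motion planning rules: along the segment, or through one of two fixed
directions `e` and `f`. A rule applies where its weight is positive. -/
def plannerWeight (e f : V) (i : Fin 3) (x y : V) : ℝ :=
  max 0 (![max (cosGap x y) (max (1 - ‖x‖) (1 - ‖y‖)), min (cosGap x e) (cosGap y e),
    min (cosGap x f) (cosGap y f)] i)

/-- The paths of the three motion planning rules. -/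
def plannerPath (e f : V) (i : Fin 3) (x y : V) (t : ℝ) : V :=
  ![(1 - t) • x + t • y, brokenLine e x y t, brokenLine f x y t] i

theorem continuous_plannerWeight (e f : V) (i : Fin 3) :
    Continuous fun p : V × V => plannerWeight e f i p.1 p.2 := by
  fin_cases i <;> simp [plannerWeight] <;> fun_prop

theorem continuous_plannerPath (e f : V) (i : Fin 3) :
    Continuous fun p : (V × V) × ℝ => plannerPath e f i p.1.1 p.1.2 p.2 := by
  fin_cases i <;> simp [plannerPath, brokenLine] <;> fun_prop

theorem plannerPath_zero (e f : V) (i : Fin 3) (x y : V) : plannerPath e f i x y 0 = x := by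
  fin_cases i <;> simp [plannerPath, brokenLine]

theorem plannerPath_one (e f : V) (i : Fin 3) (x y : V) : plannerPath e f i x y 1 = y := by
  fin_cases i <;> norm_num [plannerPath, brokenLine]

theorem plannerWeight_nonneg (e f : V) (i : Fin 3) (x y : V) : 0 ≤ plannerWeight e f i x y :=
  le_max_left _ _

theorem sq_le_norm_plannerPath_sq {e f x y : V} {i : Fin 3} (he : ‖e‖ = 1) (hf : ‖f‖ = 1)
    (hi : 0 < plannerWeight e f i x y) {r t : ℝ} (hr : 1 ≤ r) (hx : r ≤ ‖x‖) (hy : r ≤ ‖y‖)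
    (ht0 : 0 ≤ t) (ht1 : t ≤ 1) : r ^ 2 ≤ 20 * ‖plannerPath e f i x y t‖ ^ 2 := by
  have hr0 : 0 ≤ r := zero_le_one.trans hr
  rw [plannerWeight, lt_max_iff, or_iff_right (lt_irrefl _)] at hi
  fin_cases i
  · have h : 0 < cosGap x y ∨ 0 < 1 - ‖x‖ ∨ 0 < 1 - ‖y‖ := by simpa using hi
    refine sq_le_norm_segment_sq ?_ hr0 hx hy ht0 ht1
    rcases h with h | h | h
    · exact h.le
    · linarith
    · linarith
  · have h : 0 < cosGap x e ∧ 0 < cosGap y e := by simpa using hi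
    exact sq_le_norm_brokenLine_sq he h.1.le h.2.le hr0 hx hy ht0 ht1
  · have h : 0 < cosGap x f ∧ 0 < cosGap y f := by simpa using hi
    exact sq_le_norm_brokenLine_sq hf h.1.le h.2.le hr0 hx hy ht0 ht1

theorem cosGap_pos_cover {e f x y : V} (he : ‖e‖ = 1) (hf : ‖f‖ = 1) (hef : inner ℝ e f = 0)
    (hx : ‖x‖ = 1) (hy : ‖y‖ = 1) : 0 < cosGap x y ∨ (0 < cosGap x e ∧ 0 < cosGap y e) ∨
      (0 < cosGap x f ∧ 0 < cosGap y f) := by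
  by_contra! h
  obtain ⟨h0, h1, h2⟩ := h
  have hadd : ‖e + f‖ ^ 2 = 2 := by rw [norm_add_sq_real, he, hf, hef]; norm_num
  have hsub : ‖e - f‖ ^ 2 = 2 := by rw [norm_sub_sq_real, he, hf, hef]; norm_num
  have hadd' : 27 / 20 < ‖e + f‖ := by nlinarith [norm_nonneg (e + f)]
  have hsub' : 27 / 20 < ‖e - f‖ := by nlinarith [norm_nonneg (e - f)]
  have h0' := norm_add_le_of_cosGap_nonpos hx hy h0
  have same : ∀ z : V, ‖z‖ = 1 → cosGap z e ≤ 0 → cosGap z f ≤ 0 → False := by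
    intro z hz hze hzf
    have h3 := norm_add_le_of_cosGap_nonpos hz he hze
    have h4 := norm_add_le_of_cosGap_nonpos hz hf hzf
    have h5 : e - f = (z + e) - (z + f) := by abel
    have h6 := norm_sub_le (z + e) (z + f)
    rw [← h5] at h6
    linarith
  have diff : ∀ z w : V, ‖z‖ = 1 → ‖w‖ = 1 → ‖z + w‖ ≤ 9 / 20 → cosGap z e ≤ 0 →
      cosGap w f ≤ 0 → False := by
    intro z w hz hw hzw hze hwf
    have h3 := norm_add_le_of_cosGap_nonpos hz he hze
    have h4 := norm_add_le_of_cosGap_nonpos hw hf hwf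
    have h5 : e + f = ((z + e) + (w + f)) - (z + w) := by abel
    have h6 := norm_sub_le ((z + e) + (w + f)) (z + w)
    have h7 := norm_add_le (z + e) (w + f)
    rw [← h5] at h6
    linarith
  by_cases hxe : 0 < cosGap x e
  · have hye := h1 hxe
    by_cases hxf : 0 < cosGap x f
    · exact same y hy hye (h2 hxf)
    · exact diff y x hy hx (by rwa [add_comm]) hye (not_lt.1 hxf)
  · by_cases hxf : 0 < cosGap x f
    · exact diff x y hx hy h0' (not_lt.1 hxe) (h2 hxf)
    · exact same x hx (not_lt.1 hxe) (not_lt.1 hxf)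

theorem exists_plannerWeight_pos {e f : V} (he : ‖e‖ = 1) (hf : ‖f‖ = 1) (hef : inner ℝ e f = 0)
    (x y : V) : ∃ i, 0 < plannerWeight e f i x y := by
  have h0 : (0 < cosGap x y ∨ 0 < 1 - ‖x‖ ∨ 0 < 1 - ‖y‖) → ∃ i, 0 < plannerWeight e f i x y :=
    fun h => ⟨0, lt_max_of_lt_right (by simpa only [Matrix.cons_val_zero, lt_max_iff] using h)⟩
  by_cases hx : ‖x‖ < 1
  · exact h0 (Or.inr (Or.inl (by linarith)))
  by_cases hy : ‖y‖ < 1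
  · exact h0 (Or.inr (Or.inr (by linarith)))
  have hx0 : 0 < ‖x‖ := by linarith
  have hy0 : 0 < ‖y‖ := by linarith
  have hx' : 0 < ‖x‖⁻¹ := inv_pos.2 hx0
  have hy' : 0 < ‖y‖⁻¹ := inv_pos.2 hy0
  have h := cosGap_pos_cover he hf hef (x := ‖x‖⁻¹ • x) (y := ‖y‖⁻¹ • y)
    (by simp [norm_smul, hx0.ne']) (by simp [norm_smul, hy0.ne'])
  simp only [cosGap_smul_left _ _ hx'.le, cosGap_smul_left _ _ hy'.le,
    cosGap_smul_right _ _ hy'.le, mul_pos_iff_of_pos_left hx', mul_pos_iff_of_pos_left hy'] at h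
  rcases h with h | h | h
  · exact h0 (Or.inl h)
  · exact ⟨1, by simpa [plannerWeight] using h⟩
  · exact ⟨2, by simpa [plannerWeight] using h⟩

theorem exists_last_argmax {ι : Type*} [LinearOrder ι] [Finite ι] [Nonempty ι] (f : ι → ℝ) :
    ∃ i, ∀ k, f k ≤ f i ∧ (i < k → f k < f i) := by
  obtain ⟨i, hi⟩ := Finite.exists_max fun i => toLex (f i, i)
  refine ⟨i, fun k => ?_⟩
  have h := Prod.Lex.toLex_le_toLex.1 (hi k)
  rcases h with h | ⟨h, h'⟩
  · exact ⟨h.le, fun _ => h⟩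
  · exact ⟨h.le, fun hk => absurd h' (not_le.2 hk)⟩

/-- The set where the product of weights at `a` is positive and strictly larger than that at every
other index on the same antidiagonal. -/
def dominantSet {X : Type*} (f g : Fin 3 → X → ℝ) (a : Fin 3 × Fin 3) : Set X :=
  {p | 0 < f a.1 p * g a.2 p} ∩ ⋂ b : Fin 3 × Fin 3, ⋂ _ : (b.1 : ℕ) + b.2 = a.1 + a.2 ∧ b ≠ a,
    {p | f b.1 p * g b.2 p < f a.1 p * g a.2 p}

theorem isOpen_dominantSet {X : Type*} [TopologicalSpace X] {f g : Fin 3 → X → ℝ}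
    (hf : ∀ i, Continuous (f i)) (hg : ∀ i, Continuous (g i)) (a : Fin 3 × Fin 3) :
    IsOpen (dominantSet f g a) :=
  (isOpen_lt continuous_const ((hf _).mul (hg _))).inter <| isOpen_iInter_of_finite fun _ =>
    isOpen_iInter_of_finite fun _ => isOpen_lt ((hf _).mul (hg _)) ((hf _).mul (hg _))

theorem eq_of_mem_dominantSet {X : Type*} {f g : Fin 3 → X → ℝ} {a b : Fin 3 × Fin 3} {p : X}
    (ha : p ∈ dominantSet f g a) (hb : p ∈ dominantSet f g b)
    (hab : (b.1 : ℕ) + b.2 = a.1 + a.2) : b = a := by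
  by_contra hne
  have h1 : f b.1 p * g b.2 p < f a.1 p * g a.2 p := mem_iInter₂.1 ha.2 b ⟨hab, hne⟩
  have h2 : f a.1 p * g a.2 p < f b.1 p * g b.2 p :=
    mem_iInter₂.1 hb.2 a ⟨hab.symm, Ne.symm hne⟩
  exact lt_asymm h1 h2

theorem exists_mem_dominantSet {X : Type*} {f g : Fin 3 → X → ℝ} {p : X} (hf : ∀ i, 0 ≤ f i p)
    (hg : ∀ i, 0 ≤ g i p) (hf' : ∃ i, 0 < f i p) (hg' : ∃ i, 0 < g i p) :
    ∃ a, p ∈ dominantSet f g a := by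
  obtain ⟨i, hi⟩ := exists_last_argmax fun i => f i p
  obtain ⟨j, hj⟩ := exists_last_argmax fun i => g i p
  obtain ⟨i₀, hi₀⟩ := hf'
  obtain ⟨j₀, hj₀⟩ := hg'
  have hi' : 0 < f i p := hi₀.trans_le (hi i₀).1
  have hj' : 0 < g j p := hj₀.trans_le (hj j₀).1
  refine ⟨(i, j), mul_pos hi' hj', mem_iInter₂.2 ?_⟩
  rintro ⟨k, l⟩ ⟨hsum, hne⟩
  change f k p * g l p < f i p * g j p
  simp only [ne_eq, Prod.mk.injEq, Fin.ext_iff] at hne hsum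
  rcases lt_or_ge i k with hk | hk
  · exact (mul_le_mul_of_nonneg_left (hj l).1 (hf k)).trans_lt
      (mul_lt_mul_of_pos_right ((hi k).2 hk) hj')
  · have hl : j < l := by
      simp only [Fin.lt_def, Fin.le_def] at hk ⊢
      lia
    exact (mul_le_mul_of_nonneg_right (hi k).1 (hg l)).trans_lt
      (mul_lt_mul_of_pos_left ((hj l).2 hl) hi')

variable (V W) in
/-- Pairs of points of the product of the unit sphere of `V` with `W`. -/
abbrev SpherePair := (sphere (0 : V) 1 × W) × (sphere (0 : V) 1 × W)

theorem PTCLE_sphere_prod_four [FiniteDimensional ℝ V] [FiniteDimensional ℝ W] {e f : V}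
    (he : ‖e‖ = 1) (hf : ‖f‖ = 1) (hef : inner ℝ e f = 0) {e' f' : W} (he' : ‖e'‖ = 1)
    (hf' : ‖f'‖ = 1) (hef' : inner ℝ e' f' = 0) : PTCLE (sphere (0 : V) 1 × W) 4 := by
  have : ProperSpace V := FiniteDimensional.proper ℝ V
  have : ProperSpace W := FiniteDimensional.proper ℝ W
  let u : Fin 3 → SpherePair V W → ℝ := fun i p => plannerWeight e f i p.1.1 p.2.1
  let w : Fin 3 → SpherePair V W → ℝ := fun i p => plannerWeight e' f' i p.1.2 p.2.2
  have hu : ∀ i, Continuous (u i) := fun i =>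
    (continuous_plannerWeight e f i).comp
      (f := fun p : SpherePair V W => ((p.1.1 : V), (p.2.1 : V))) (by fun_prop)
  have hw : ∀ i, Continuous (w i) := fun i =>
    (continuous_plannerWeight e' f' i).comp
      (f := fun p : SpherePair V W => (p.1.2, p.2.2)) (by fun_prop)
  have hpos : ∀ {a p}, p ∈ dominantSet u w a → 0 < u a.1 p ∧ 0 < w a.2 p := fun {a p} hp => by
    have h : 0 < u a.1 p * w a.2 p := hp.1
    exact ⟨pos_of_mul_pos_left h (plannerWeight_nonneg _ _ _ _ _),
      pos_of_mul_pos_right h (plannerWeight_nonneg _ _ _ _ _)⟩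
  let T : Fin 3 × Fin 3 → SpherePair V W × I → sphere (0 : V) 1 × W := fun a z =>
    (radialProj ⟨e, mem_sphere_zero_iff_norm.2 he⟩ (plannerPath e f a.1 z.1.1.1 z.1.2.1 z.2),
      plannerPath e' f' a.2 z.1.1.2 z.1.2.2 z.2)
  have hT : ∀ a z, z.1 ∈ dominantSet u w a → ContinuousAt (T a) z := by
    intro a z hz
    have hc : Continuous fun z : SpherePair V W × I => plannerPath e f a.1 z.1.1.1 z.1.2.1 z.2 :=
      (continuous_plannerPath e f a.1).comp
        (f := fun z : SpherePair V W × I => (((z.1.1.1 : V), (z.1.2.1 : V)), (z.2 : ℝ)))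
        (by fun_prop)
    have hc' : Continuous fun z : SpherePair V W × I =>
        plannerPath e' f' a.2 z.1.1.2 z.1.2.2 z.2 :=
      (continuous_plannerPath e' f' a.2).comp
        (f := fun z : SpherePair V W × I => ((z.1.1.2, z.1.2.2), (z.2 : ℝ))) (by fun_prop)
    have hne : plannerPath e f a.1 z.1.1.1 z.1.2.1 z.2 ≠ 0 := by
      intro h0
      have := sq_le_norm_plannerPath_sq he hf (hpos hz).1 le_rfl
        (norm_eq_of_mem_sphere z.1.1.1).ge (norm_eq_of_mem_sphere z.1.2.1).ge z.2.2.1 z.2.2.2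
      rw [h0] at this
      norm_num at this
    exact ((continuousAt_radialProj _ hne).comp
      (f := fun z : SpherePair V W × I => plannerPath e f a.1 z.1.1.1 z.1.2.1 z.2)
      hc.continuousAt).prodMk hc'.continuousAt
  let U : Fin 5 → Set (SpherePair V W) := fun k =>
    ⋃ a : Fin 3 × Fin 3, ⋃ _ : (a.1 : ℕ) + a.2 = k, dominantSet u w a
  have hUex : ∀ k (p : U k), ∃ a : Fin 3 × Fin 3,
      (a.1 : ℕ) + a.2 = k ∧ (p : SpherePair V W) ∈ dominantSet u w a := fun k p => by
    simpa only [U, mem_iUnion, exists_prop] using p.2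
  choose idx hidx hmem using hUex
  have hcont : ∀ k, Continuous fun z : U k × I => T (idx k z.1) (z.1, z.2) := by
    intro k
    rw [continuous_iff_continuousAt]
    rintro ⟨p, t⟩
    have hincl : Continuous fun z : U k × I => ((z.1 : SpherePair V W), z.2) := by fun_prop
    have h1 : ContinuousAt (fun z : U k × I => T (idx k p) (z.1, z.2)) (p, t) :=
      ContinuousAt.comp (x := (p, t)) (hT (idx k p) (p, t) (hmem k p)) hincl.continuousAt
    refine h1.congr ?_
    have hopen : IsOpen {z : U k × I | (z.1 : SpherePair V W) ∈ dominantSet u w (idx k p)} :=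
      (isOpen_dominantSet hu hw (idx k p)).preimage (by fun_prop)
    filter_upwards [hopen.mem_nhds (show (p, t) ∈ _ from hmem k p)] with z hz
    rw [eq_of_mem_dominantSet hz (hmem k z.1) ((hidx k z.1).trans (hidx k p).symm)]
  refine ⟨U, fun k => isOpen_iUnion fun a => isOpen_iUnion fun _ => isOpen_dominantSet hu hw a,
    eq_univ_of_forall fun p => ?_, fun k => ContinuousMap.curry ⟨_, hcont k⟩,
    fun k => ContinuousMap.continuous _, fun k p => ?_, fun K hK => ?_⟩
  · obtain ⟨a, ha⟩ := exists_mem_dominantSet (f := u) (g := w) (p := p)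
      (fun i => plannerWeight_nonneg _ _ _ _ _) (fun i => plannerWeight_nonneg _ _ _ _ _)
      (exists_plannerWeight_pos he hf hef _ _) (exists_plannerWeight_pos he' hf' hef' _ _)
    exact mem_iUnion.2 ⟨⟨a.1 + a.2, by lia⟩, mem_iUnion₂.2 ⟨a, rfl, ha⟩⟩
  · constructor
    · exact Prod.ext (by simp [T, plannerPath_zero, radialProj_coe]) (by simp [T, plannerPath_zero])
    · exact Prod.ext (by simp [T, plannerPath_one, radialProj_coe]) (by simp [T, plannerPath_one])
  · obtain ⟨R, hR, hKR⟩ := (hK.image continuous_snd).isBounded.subset_ball_lt 1 0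
    refine ⟨univ ×ˢ closedBall 0 (5 * R), isCompact_univ.prod (isCompact_closedBall _ _),
      fun x hx => ⟨mem_univ _, ?_⟩, fun k p hx hy t ht => ?_⟩
    · have := hKR ⟨x, hx, rfl⟩
      rw [mem_ball_zero_iff] at this
      rw [mem_closedBall_zero_iff]
      linarith
    · simp only [mem_prod, mem_univ, true_and, mem_closedBall_zero_iff, not_le] at hx hy
      have h1 := sq_le_norm_plannerPath_sq he' hf' (hpos (hmem k p)).2 (r := 5 * R) (by linarith)
        hx.le hy.le t.2.1 t.2.2
      have h2 := hKR ⟨_, ht, rfl⟩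
      rw [mem_ball_zero_iff] at h2
      change ‖plannerPath e' f' (idx k p).2 p.1.1.2 p.1.2.2 t‖ < R at h2
      nlinarith [norm_nonneg (plannerPath e' f' (idx k p).2 p.1.1.2 p.1.2.2 (t : ℝ))]

end UpperBound

/-- For all `n ≥ 1` and `m ≥ 2`, `2 ≤ pTC (Sⁿ × ℝᵐ) ≤ 4`, where `Sⁿ` is the unit sphere
in `ℝ^{n+1}`. -/
theorem pTC_sphere_prod_euclidean (n m : ℕ) (hn : 1 ≤ n) (hm : 2 ≤ m) :
    2 ≤ pTC (Metric.sphere (0 : EuclideanSpace ℝ (Fin (n + 1))) 1 × EuclideanSpace ℝ (Fin m)) ∧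
    pTC (Metric.sphere (0 : EuclideanSpace ℝ (Fin (n + 1))) 1 × EuclideanSpace ℝ (Fin m)) ≤ 4 := by
  have single : ∀ {k : ℕ} (hk : 1 < k),
      ‖EuclideanSpace.single (⟨0, by lia⟩ : Fin k) (1 : ℝ)‖ = 1 ∧
      ‖EuclideanSpace.single (⟨1, hk⟩ : Fin k) (1 : ℝ)‖ = 1 ∧
      inner ℝ (EuclideanSpace.single (⟨0, by lia⟩ : Fin k) (1 : ℝ))
        (EuclideanSpace.single (⟨1, hk⟩ : Fin k) (1 : ℝ)) = 0 := fun hk => by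
    simp [EuclideanSpace.inner_single_left]
  obtain ⟨he, hf, hef⟩ := single (show 1 < n + 1 by lia)
  obtain ⟨he', hf', hef'⟩ := single (show 1 < m by lia)
  refine ⟨le_sInf ?_, sInf_le ⟨4, rfl, PTCLE_sphere_prod_four he hf hef he' hf' hef'⟩⟩
  rintro _ ⟨k, rfl, hk⟩
  by_contra hlt
  refine not_PTCLE_of_le_one (⟨_, mem_sphere_zero_iff_norm.2 he⟩,
    ⟨_, mem_sphere_zero_iff_norm.2 he'⟩) (k := k) ?_ hk
  have : (k : ℕ∞) < (2 : ℕ) := not_le.1 hlt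
  rw [Nat.cast_lt] at this
  lia

end
end

section
/- For every integer n ≥ 1, pTC(Sⁿ_B) = 2, where the Brown sphere Sⁿ_B is the quotient space of the disjoint union of [0,∞) and Sⁿ × ℕ obtained by identifying, for each natural number k, the point k ∈ [0,∞) with the point (x₀, k) ∈ Sⁿ × ℕ, for a fixed base point x₀ of the unit sphere Sⁿ in ℝ^{n+1} (and ℕ carries the discrete topology). -/
open Set unitInterval
open scoped NNReal ENNReal

noncomputable section

universe u v

/-- The Brown sphere `Sⁿ_B`: the quotient of `[0, ∞) ⊕ (Sⁿ × ℕ)` identifying, for each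
`k : ℕ`, the point `k ∈ [0, ∞)` with `(x₀, k)`. -/
abbrev BrownSphere (n : ℕ) (x₀ : Metric.sphere (0 : EuclideanSpace ℝ (Fin (n + 1))) 1) :=
  Quot (fun a b : ℝ≥0 ⊕ (Metric.sphere (0 : EuclideanSpace ℝ (Fin (n + 1))) 1 × ℕ) =>
    ∃ k : ℕ, a = Sum.inl (k : ℝ≥0) ∧ b = Sum.inr (x₀, k))
open MeasureTheory in
/-- The polynomial dependence on `t` of `det (1 + t A)`, expressed through Lagrange interpolation:
the value at `1` is a fixed linear combination of the values at sufficiently many nodes. -/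
theorem ContinuousLinearMap.det_one_add_eq_sum_interpolate {W : Type*} [NormedAddCommGroup W]
    [NormedSpace ℝ W] [FiniteDimensional ℝ W] {s : Finset ℕ} {v : ℕ → ℝ} (hv : Set.InjOn v s)
    (hs : Module.finrank ℝ W < s.card) (A : W →L[ℝ] W) :
    (1 + A).det = ∑ i ∈ s, (1 + v i • A).det * (Lagrange.basis s v i).eval 1 := by
  classical
  let b := Module.finBasis ℝ W
  let M := LinearMap.toMatrix b b (A : W →ₗ[ℝ] W)
  let p : Polynomial ℝ := Matrix.det ((Polynomial.X : Polynomial ℝ) • M.map Polynomial.C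
    + (1 : Matrix _ _ ℝ).map Polynomial.C)
  have hp : ∀ t : ℝ, p.eval t = (1 + t • A).det := by
    intro t
    have h1 : (1 + t • A).det = LinearMap.det ((1 : W →ₗ[ℝ] W) + t • (A : W →ₗ[ℝ] W)) := rfl
    rw [h1, ← LinearMap.det_toMatrix b]
    simp only [p]
    rw [← Polynomial.coe_evalRingHom, RingHom.map_det]
    congr 1
    ext i j
    by_cases hij : i = j <;> simp [M, LinearMap.toMatrix_one, hij] <;> ring
  have hdeg : p.degree < s.card := by
    refine lt_of_le_of_lt Polynomial.degree_le_natDegree ?_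
    have := Polynomial.natDegree_det_X_add_C_le M 1
    rw [Fintype.card_fin] at this
    exact_mod_cast this.trans_lt hs
  have := Lagrange.eq_interpolate (f := p) hv hdeg
  have h1 := hp 1
  rw [one_smul] at h1
  rw [← h1]
  conv_lhs => rw [this]
  rw [Lagrange.interpolate_apply, Polynomial.eval_finsetSum]
  simp [hp]

open MeasureTheory Metric in
/-- There is no continuously differentiable retraction of a closed ball onto its boundary
sphere. -/
theorem not_exists_contDiff_retraction_s19 {W : Type*} [NormedAddCommGroup W] [InnerProductSpace ℝ W]
    [FiniteDimensional ℝ W] {ρ : ℝ} (hρ : 0 < ρ) {r : W → W} (hr : ContDiff ℝ 1 r)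
    (hnorm : ∀ z, ‖r z‖ = ρ) (hid : ∀ z, ‖z‖ = ρ → r z = z) : False := by
  classical
  borelize W
  let μ : Measure W := Measure.addHaar
  set B : Set W := closedBall 0 ρ with hB
  have hBc : IsCompact B := isCompact_closedBall 0 ρ
  let g : W → W := fun z => r z - z
  have hg : ContDiff ℝ 1 g := hr.sub contDiff_id
  have hgd : Differentiable ℝ g := hg.differentiable one_ne_zero
  have hg' : Continuous (fderiv ℝ g) := hg.continuous_fderiv one_ne_zero
  have hg0 : ∀ z, ‖z‖ = ρ → g z = 0 := fun z hz => by simp [g, hid z hz]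
  obtain ⟨C₀, hC₀⟩ := hBc.exists_bound_of_continuousOn hg'.continuousOn
  let C : ℝ≥0 := Real.toNNReal C₀ + 1
  have hC : ∀ z ∈ B, ‖fderiv ℝ g z‖₊ ≤ C := fun z hz => by
    rw [← NNReal.coe_le_coe]
    push_cast [C]
    have := hC₀ z hz
    have := Real.le_coe_toNNReal C₀
    linarith
  have hlipB : LipschitzOnWith C g B :=
    (convex_closedBall 0 ρ).lipschitzOnWith_of_nnnorm_fderiv_le (fun z _ => hgd z) hC
  -- the extension of `g` by zero is still Lipschitz
  let G : W → W := B.indicator g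
  have hmix : ∀ z ∈ B, ∀ w ∉ B, ‖g z‖ ≤ C * ‖z - w‖ := by
    intro z hz w hw
    have hz' : ‖z‖ ≤ ρ := by simpa [hB] using hz
    have hw' : ρ < ‖w‖ := by simpa [hB] using hw
    have hcont : ContinuousOn (fun t : ℝ => ‖AffineMap.lineMap z w t‖) (Icc 0 1) := by
      apply Continuous.continuousOn
      exact AffineMap.lineMap_continuous.norm
    obtain ⟨t, ht, htρ⟩ : ρ ∈ (fun t : ℝ => ‖AffineMap.lineMap z w t‖) '' Icc 0 1 := by
      apply intermediate_value_Icc zero_le_one hcont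
      simp [hz', hw'.le]
    have htρ' : ‖AffineMap.lineMap z w t‖ = ρ := htρ
    have h2 := hlipB.dist_le_mul z hz (AffineMap.lineMap z w t) (by simp [hB, htρ'])
    rw [hg0 _ htρ', dist_zero_right, dist_left_lineMap, Real.norm_of_nonneg ht.1,
      dist_eq_norm] at h2
    refine h2.trans ?_
    gcongr
    exact mul_le_of_le_one_left (norm_nonneg _) ht.2
  have hlip : LipschitzWith C G := by
    refine LipschitzWith.of_dist_le_mul fun z w => ?_
    by_cases hz : z ∈ B <;> by_cases hw : w ∈ B
    · simpa [G, hz, hw] using hlipB.dist_le_mul z hz w hw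
    · simpa [G, hz, hw, dist_eq_norm] using hmix z hz w hw
    · simpa [G, hz, hw, dist_eq_norm, norm_sub_rev] using hmix w hw z hz
    · simp only [G, hz, hw, not_false_eq_true, indicator_of_notMem, dist_self]
      positivity
  have hdetc : Continuous (fun A : W →L[ℝ] W => A.det) := ContinuousLinearMap.continuous_det
  obtain ⟨δ, hδ, hδdet⟩ : ∃ δ > 0, ∀ A : W →L[ℝ] W, ‖A‖ < δ → 0 < (1 + A).det := by
    have h1 : ∀ᶠ A : W →L[ℝ] W in nhds 0, 0 < (1 + A).det := by
      have : Continuous (fun A : W →L[ℝ] W => (1 + A).det) := hdetc.comp (by fun_prop)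
      refine this.continuousAt.eventually_const_lt ?_
      have : (1 : W →L[ℝ] W).det = 1 := LinearMap.det_id
      simp [this]
    obtain ⟨δ, hδ, h⟩ := Metric.eventually_nhds_iff.1 h1
    exact ⟨δ, hδ, fun A hA => h (by simpa using hA)⟩
  have hCpos : (0 : ℝ) < C := by simp only [C]; positivity
  have hvol : ∀ t : ℝ, 0 < t → t ≤ 1 → t * C < 1 → t * C < δ →
      ∫ z in B, (1 + t • fderiv ℝ g z).det ∂μ = μ.real B := by
    intro t ht0 ht1 htC htδ
    let f : W → W := fun z => z + t • G z
    have happ : ApproximatesLinearOn f ((ContinuousLinearEquiv.refl ℝ W : W ≃L[ℝ] W) : W →L[ℝ] W)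
        univ (Real.toNNReal t * C) := by
      rw [ApproximatesLinearOn.approximatesLinearOn_iff_lipschitzOnWith, lipschitzOnWith_univ]
      refine LipschitzWith.of_dist_le_mul fun z w => ?_
      have := hlip.dist_le_mul z w
      simp only [f, Pi.sub_apply, ContinuousLinearEquiv.coe_refl, ContinuousLinearMap.coe_id', id,
        add_sub_cancel_left]
      rw [NNReal.coe_mul, Real.coe_toNNReal t ht0.le, dist_smul₀, Real.norm_of_nonneg ht0.le,
        mul_assoc]
      gcongr
    have hlt : Subsingleton W ∨ (Real.toNNReal t * C : ℝ≥0) <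
        ‖((ContinuousLinearEquiv.refl ℝ W).symm : W →L[ℝ] W)‖₊⁻¹ := by
      rcases subsingleton_or_nontrivial W with h | h
      · exact Or.inl h
      · right
        have : ‖((ContinuousLinearEquiv.refl ℝ W).symm : W →L[ℝ] W)‖₊ = 1 := by
          simp
        rw [this, inv_one, ← NNReal.coe_lt_coe, NNReal.coe_mul, Real.coe_toNNReal t ht0.le]
        exact htC
    have hinj : Function.Injective f := injOn_univ.1 (happ.injOn hlt)
    have hsurj : Function.Surjective f := happ.surjective hlt
    have himage : f '' B = B := by
      apply Subset.antisymm
      · rintro _ ⟨z, hz, rfl⟩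
        have hz' : ‖z‖ ≤ ρ := by simpa [hB] using hz
        have : f z = (1 - t) • z + t • r z := by
          simp only [f, G, indicator_of_mem hz, g]; module
        rw [hB, mem_closedBall_zero_iff, this]
        refine (norm_add_le _ _).trans ?_
        rw [norm_smul, norm_smul, hnorm, Real.norm_of_nonneg ht0.le,
          Real.norm_of_nonneg (by linarith)]
        nlinarith
      · intro y hy
        obtain ⟨z, rfl⟩ := hsurj y
        by_cases hz : z ∈ B
        · exact ⟨z, hz, rfl⟩
        · have : f z = z := by simp [f, G, hz]
          exact absurd (this ▸ hy) hz
    have hderiv : ∀ z ∈ B, HasFDerivWithinAt f (1 + t • fderiv ℝ g z) B z := by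
      intro z hz
      have h1 : HasFDerivWithinAt (fun z => z + t • g z) (1 + t • fderiv ℝ g z) B z :=
        ((hasFDerivAt_id z).add ((hgd z).hasFDerivAt.const_smul t)).hasFDerivWithinAt
      exact h1.congr (fun w hw => by simp [f, G, hw]) (by simp [f, G, hz])
    have h2 := integral_image_eq_integral_abs_det_fderiv_smul μ hBc.measurableSet hderiv
      hinj.injOn (fun _ => (1 : ℝ))
    rw [himage] at h2
    simp only [smul_eq_mul, mul_one, integral_const, measureReal_restrict_apply_univ] at h2
    rw [h2]
    refine setIntegral_congr_fun hBc.measurableSet fun z hz => ?_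
    refine (abs_of_pos (hδdet _ ?_)).symm
    rw [norm_smul, Real.norm_of_nonneg ht0.le]
    exact lt_of_le_of_lt (mul_le_mul_of_nonneg_left (by exact_mod_cast hC z hz) ht0.le) htδ
  -- interpolate from small parameters to `t = 1`
  obtain ⟨ε, hε0, hε1, hεC, hεδ⟩ : ∃ ε : ℝ, 0 < ε ∧ ε ≤ 1 ∧ ε * C < 1 ∧ ε * C < δ := by
    refine ⟨min 1 (min (1 / (2 * C)) (δ / (2 * C))), by positivity, min_le_left _ _, ?_, ?_⟩
    · calc _ ≤ 1 / (2 * C) * (C : ℝ) := by gcongr; exact (min_le_right _ _).trans (min_le_left _ _)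
        _ < 1 := by field_simp; norm_num
    · calc _ ≤ δ / (2 * C) * (C : ℝ) := by
            gcongr; exact (min_le_right _ _).trans (min_le_right _ _)
        _ < δ := by field_simp; linarith
  let s := Finset.range (Module.finrank ℝ W + 1)
  let v : ℕ → ℝ := fun i => ε / (i + 1)
  have hv0 : ∀ i, 0 < v i := fun i => by simp only [v]; positivity
  have hvε : ∀ i, v i ≤ ε := fun i => div_le_self hε0.le (by linarith [Nat.cast_nonneg (α := ℝ) i])
  have hv : Set.InjOn v s := by
    intro i _ j _ hij
    simp only [v] at hij
    field_simp at hij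
    exact_mod_cast add_right_cancel hij.symm
  have hBint : ∫ z in B, (1 + fderiv ℝ g z).det ∂μ = μ.real B := by
    simp only [fun z => ContinuousLinearMap.det_one_add_eq_sum_interpolate hv
      (by simp [s] : Module.finrank ℝ W < s.card) (fderiv ℝ g z)]
    rw [integral_finsetSum]
    · have hsum : ∑ i ∈ s, (Lagrange.basis s v i).eval 1 = (1 : ℝ) := by
        rw [← Polynomial.eval_finsetSum, Lagrange.sum_basis hv ⟨0, by simp [s]⟩,
          Polynomial.eval_one]
      calc _ = ∑ i ∈ s, μ.real B * (Lagrange.basis s v i).eval 1 := by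
            refine Finset.sum_congr rfl fun i _ => ?_
            rw [integral_mul_const, hvol (v i) (hv0 i) ((hvε i).trans hε1)]
            · exact lt_of_le_of_lt (by gcongr; exact hvε i) hεC
            · exact lt_of_le_of_lt (by gcongr; exact hvε i) hεδ
        _ = μ.real B := by rw [← Finset.mul_sum, hsum, mul_one]
    · intro i _
      refine ContinuousOn.integrableOn_compact hBc ?_
      have : Continuous fun z => (1 + v i • fderiv ℝ g z).det := hdetc.comp (by fun_prop)
      exact (this.mul continuous_const).continuousOn
  have hzero : ∀ z, (1 + fderiv ℝ g z).det = 0 := by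
    intro z
    have hrd : HasFDerivAt r (fderiv ℝ r z) z := (hr.differentiable one_ne_zero z).hasFDerivAt
    have h1 : 1 + fderiv ℝ g z = fderiv ℝ r z := by
      have : fderiv ℝ g z = fderiv ℝ r z - 1 := (hrd.sub (hasFDerivAt_id z)).fderiv
      rw [this]; abel
    rw [h1]
    by_contra hdet
    have hsurj : Function.Surjective (fderiv ℝ r z) := by
      exact ((Module.End.isUnit_iff _).1 ((LinearMap.isUnit_iff_isUnit_det
        ((fderiv ℝ r z : W →L[ℝ] W) : W →ₗ[ℝ] W)).2 (isUnit_iff_ne_zero.2 hdet))).2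
    obtain ⟨w, hw⟩ := hsurj (r z)
    have h2 := hrd.norm_sq
    have h3 : (fun y => ‖r y‖ ^ 2) = fun _ => ρ ^ 2 := by funext y; rw [hnorm]
    rw [h3] at h2
    have h4 := h2.unique (hasFDerivAt_const (ρ ^ 2) z)
    have h5 := congrArg (fun L : W →L[ℝ] ℝ => L w) h4
    simp [hw, hnorm, hρ.ne'] at h5
  have hpos : 0 < μ.real B := by
    refine ENNReal.toReal_pos (measure_closedBall_pos μ 0 hρ).ne' hBc.measure_lt_top.ne
  simp only [hzero, integral_zero] at hBint
  exact hpos.ne hBint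

open Filter Topology Manifold in
/-- A nowhere vanishing continuous vector field on a Euclidean space cannot agree with the identity
outside a ball. -/
theorem exists_eq_zero_of_eq_id_outside {W : Type*} [NormedAddCommGroup W] [InnerProductSpace ℝ W]
    [FiniteDimensional ℝ W] {R : ℝ} (hR : 0 ≤ R) {Φ : W → W} (hΦ : Continuous Φ)
    (hid : ∀ z, R ≤ ‖z‖ → Φ z = z) : ∃ z, Φ z = 0 := by
  by_contra! h0
  let t : W → Set W := fun x => {y | y ∈ Metric.ball (Φ x) ‖Φ x‖ ∧ (R + 1 ≤ ‖x‖ → y = x)}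
  have ht : ∀ x, Convex ℝ (t x) := by
    intro x
    by_cases hx : R + 1 ≤ ‖x‖
    · have : t x = Metric.ball (Φ x) ‖Φ x‖ ∩ {x} := by ext y; simp [t, hx]
      rw [this]
      exact (convex_ball _ _).inter (convex_singleton _)
    · have : t x = Metric.ball (Φ x) ‖Φ x‖ := by ext y; simp [t, hx]
      rw [this]
      exact convex_ball _ _
  obtain ⟨g, hg⟩ := exists_contMDiffMap_forall_mem_convex_of_local (n := 1) 𝓘(ℝ, W) (t := t) ht (by
    intro x
    rcases lt_or_ge ‖x‖ (R + 1) with hx | hx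
    · have h1 : ∀ᶠ y in 𝓝 x, ‖Φ x - Φ y‖ < ‖Φ y‖ := by
        refine ContinuousAt.eventually_lt (by fun_prop) (by fun_prop) ?_
        simpa using h0 x
      have h2 : ∀ᶠ y in 𝓝 x, ‖y‖ < R + 1 := continuous_norm.continuousAt.eventually_lt_const hx
      refine ⟨_, h1.and h2, fun _ => Φ x, contMDiffOn_const, fun y hy => ⟨?_, fun h => ?_⟩⟩
      · simpa [dist_eq_norm] using hy.1
      · exact absurd hy.2 h.not_gt
    · have h2 : ∀ᶠ y in 𝓝 x, R < ‖y‖ :=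
        continuous_norm.continuousAt.eventually_const_lt (by linarith)
      refine ⟨_, h2, id, contMDiffOn_id, fun y hy => ⟨?_, fun h => rfl⟩⟩
      have hy' : Φ y = y := hid y (le_of_lt hy)
      have := h0 y
      rw [hy'] at this
      simpa [hy'] using this)
  have hg0 : ∀ z, g z ≠ 0 := fun z hz => by
    have := (hg z).1
    simp [hz] at this
  have hgc : ContDiff ℝ 1 g := g.contMDiff.contDiff
  refine not_exists_contDiff_retraction_s19 (ρ := R + 1) (by linarith)
    (r := fun z => ((R + 1) * ‖g z‖⁻¹) • g z) ?_ (fun z => ?_) (fun z hz => ?_)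
  · exact (contDiff_const.mul ((hgc.norm ℝ hg0).inv fun z => norm_ne_zero_iff.2 (hg0 z))).smul hgc
  · have := norm_ne_zero_iff.2 (hg0 z)
    rw [norm_smul, norm_mul, norm_inv, norm_norm, Real.norm_of_nonneg (by linarith)]
    field_simp
  · have : g z = z := (hg z).2 hz.ge
    simp only [this, hz]
    rw [mul_inv_cancel₀ (by linarith), one_smul]

/-- A continuous map of a Euclidean space that is linearly homotopic to the identity through
nonvanishing maps outside a ball has a zero. -/
theorem exists_eq_zero_of_homotopic_id_outside {W : Type*} [NormedAddCommGroup W]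
    [InnerProductSpace ℝ W] [FiniteDimensional ℝ W] {R : ℝ} (hR : 0 ≤ R) {Φ : W → W}
    (hΦ : Continuous Φ)
    (h : ∀ z, R ≤ ‖z‖ → ∀ c : ℝ, 0 ≤ c → c ≤ 1 → (1 - c) • Φ z + c • z ≠ 0) :
    ∃ z, Φ z = 0 := by
  let c : W → ℝ := fun z => max 0 (min 1 (‖z‖ - R))
  have hc0 : ∀ z, 0 ≤ c z := fun z => le_max_left _ _
  have hc1 : ∀ z, c z ≤ 1 := fun z => max_le zero_le_one (min_le_left _ _)
  obtain ⟨z, hz⟩ := exists_eq_zero_of_eq_id_outside (R := R + 1) (by linarith)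
    (Φ := fun z => (1 - c z) • Φ z + c z • z) (by fun_prop) (fun z hz => by
      have : c z = 1 := by
        simp only [c]
        rw [min_eq_left (by linarith), max_eq_right zero_le_one]
      simp [this])
  rcases le_or_gt R ‖z‖ with hzR | hzR
  · exact absurd hz (h z hzR _ (hc0 z) (hc1 z))
  · have : c z = 0 := max_eq_left ((min_le_right _ _).trans (by linarith))
    exact ⟨z, by simpa [this] using hz⟩

/-- A Poincaré–Miranda type theorem for a product of two balls. -/
theorem exists_prod_eq_zero {E : Type*} [NormedAddCommGroup E] [InnerProductSpace ℝ E]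
    [FiniteDimensional ℝ E] {F G : E × E → E} (hF : Continuous F) (hG : Continuous G)
    (hF1 : ∀ p : E × E, 1 ≤ ‖p.1‖ → F p = p.1) (hG1 : ∀ p : E × E, 1 ≤ ‖p.2‖ → G p = p.2) :
    ∃ p, F p = 0 ∧ G p = 0 := by
  let L := WithLp.prodContinuousLinearEquiv 2 ℝ E E
  obtain ⟨z, hz⟩ := exists_eq_zero_of_homotopic_id_outside (W := WithLp 2 (E × E)) (R := 2)
    zero_le_two (Φ := fun z => L.symm (F (L z), G (L z)))
    (L.symm.continuous.comp ((hF.comp L.continuous).prodMk (hG.comp L.continuous))) (by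
      intro z hz c hc0 hc1 h0
      have h1 : (1 - c) • F (L z) + c • (L z).1 = 0 := by
        simpa using congrArg (fun w => (L w).1) h0
      have h2 : (1 - c) • G (L z) + c • (L z).2 = 0 := by
        simpa using congrArg (fun w => (L w).2) h0
      have hlt1 : ‖(L z).1‖ < 1 := by
        by_contra! hge
        rw [hF1 _ hge, ← add_smul, sub_add_cancel, one_smul] at h1
        rw [h1, norm_zero] at hge
        linarith
      have hlt2 : ‖(L z).2‖ < 1 := by
        by_contra! hge
        rw [hG1 _ hge, ← add_smul, sub_add_cancel, one_smul] at h2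
        rw [h2, norm_zero] at hge
        linarith
      have h3 : ‖z‖ ^ 2 = ‖(L z).1‖ ^ 2 + ‖(L z).2‖ ^ 2 := WithLp.prod_norm_sq_eq_of_L2 z
      nlinarith [norm_nonneg (L z).1, norm_nonneg (L z).2])
  have hz' : (F (L z), G (L z)) = 0 := by simpa using hz
  exact ⟨L z, congrArg Prod.fst hz', congrArg Prod.snd hz'⟩

/-- The radial projection onto the unit sphere, sending the origin to `x₀`. -/
def sphereProj {E : Type*} [NormedAddCommGroup E] [NormedSpace ℝ E] (x₀ : Metric.sphere (0 : E) 1)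
    (u : E) : Metric.sphere (0 : E) 1 :=
  open Classical in
  if h : u = 0 then x₀ else ⟨‖u‖⁻¹ • u, by
    rw [mem_sphere_zero_iff_norm, norm_smul, norm_inv, norm_norm,
      inv_mul_cancel₀ (norm_ne_zero_iff.2 h)]⟩

section SphereProj

variable {E : Type*} [NormedAddCommGroup E] [NormedSpace ℝ E] (x₀ : Metric.sphere (0 : E) 1)

theorem coe_sphereProj {u : E} (hu : u ≠ 0) : (sphereProj x₀ u : E) = ‖u‖⁻¹ • u := by
  simp [sphereProj, hu]

theorem continuousOn_sphereProj : ContinuousOn (sphereProj x₀) {u | u ≠ 0} := by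
  rw [Topology.IsInducing.subtypeVal.continuousOn_iff]
  refine ContinuousOn.congr (f := fun u => ‖u‖⁻¹ • u) ?_ fun u hu => coe_sphereProj x₀ hu
  exact (continuous_norm.continuousOn.inv₀ fun u hu => norm_ne_zero_iff.2 hu).smul continuousOn_id

theorem coe_sphereProj_of_norm_eq_one {u : E} (hu : ‖u‖ = 1) : (sphereProj x₀ u : E) = u := by
  have : u ≠ 0 := by rintro rfl; simp at hu
  simp [coe_sphereProj x₀ this, hu]

theorem sphereProj_coe (x : Metric.sphere (0 : E) 1) : sphereProj x₀ (x : E) = x :=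
  Subtype.ext (coe_sphereProj_of_norm_eq_one x₀ (mem_sphere_zero_iff_norm.1 x.2))

end SphereProj

/-- A partial nullhomotopy of the first projection `S × S → S`, defined on a closed set `A`, yields
a continuous map `E × E → E` that is the first projection outside the unit ball and does not vanish
over the smaller ball, nor over the cone of `A`. -/
theorem exists_continuous_extension_of_nullhomotopy {E : Type*} [NormedAddCommGroup E]
    [InnerProductSpace ℝ E] [FiniteDimensional ℝ E] (x₀ : Metric.sphere (0 : E) 1)
    {A : Set (Metric.sphere (0 : E) 1 × Metric.sphere (0 : E) 1)} (hA : IsClosed A)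
    {H : (Metric.sphere (0 : E) 1 × Metric.sphere (0 : E) 1) × I → Metric.sphere (0 : E) 1}
    (hH : ContinuousOn H (A ×ˢ univ)) (hH0 : ∀ z ∈ A, H (z, 0) = z.1)
    (hH1 : ∀ z ∈ A, H (z, 1) = x₀) :
    ∃ F : E × E → E, Continuous F ∧ (∀ p, 1 ≤ ‖p.1‖ → F p = p.1) ∧
      (∀ p, ‖p.1‖ ≤ 1 / 2 → F p ≠ 0) ∧
      ∀ p, 1 / 2 ≤ ‖p.1‖ → 1 / 2 ≤ ‖p.2‖ → (sphereProj x₀ p.1, sphereProj x₀ p.2) ∈ A →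
        F p ≠ 0 := by
  classical
  let ν : E × E → Metric.sphere (0 : E) 1 × Metric.sphere (0 : E) 1 :=
    fun p => (sphereProj x₀ p.1, sphereProj x₀ p.2)
  let P₁ : Set (E × E) := {p | 1 ≤ ‖p.1‖}
  let P₂ : Set (E × E) := {p | ‖p.1‖ ≤ 1 / 2}
  let Q : Set (E × E) := {p | 1 / 2 ≤ ‖p.1‖ ∧ ‖p.1‖ ≤ 1 ∧ 1 / 2 ≤ ‖p.2‖}
  let P₃ : Set (E × E) := Q ∩ ν ⁻¹' A
  have hP₁ : IsClosed P₁ := isClosed_le continuous_const (by fun_prop)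
  have hP₂ : IsClosed P₂ := isClosed_le (by fun_prop) continuous_const
  have hn₁ : Continuous fun p : E × E => ‖p.1‖ := by fun_prop
  have hn₂ : Continuous fun p : E × E => ‖p.2‖ := by fun_prop
  have hQ : IsClosed Q := (isClosed_le continuous_const hn₁).inter
    ((isClosed_le hn₁ continuous_const).inter (isClosed_le continuous_const hn₂))
  have hne : ∀ {u : E}, 1 / 2 ≤ ‖u‖ → u ≠ 0 := by
    rintro u hu rfl
    rw [norm_zero] at hu
    linarith
  have hν : ContinuousOn ν Q :=
    ((continuousOn_sphereProj x₀).comp continuous_fst.continuousOn fun p hp => hne hp.1).prodMk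
      ((continuousOn_sphereProj x₀).comp continuous_snd.continuousOn fun p hp => hne hp.2.2)
  have hP₃ : IsClosed P₃ := hν.preimage_isClosed_of_isClosed hQ hA
  let τ : E × E → I := fun p => projIcc 0 1 zero_le_one (2 - 2 * ‖p.1‖)
  have hτ : Continuous τ := continuous_projIcc.comp (by fun_prop)
  let f : E × E → E := fun p =>
    if 1 ≤ ‖p.1‖ then p.1 else if ‖p.1‖ ≤ 1 / 2 then x₀ else H (ν p, τ p)
  have hf₁ : ∀ p ∈ P₁, f p = p.1 := fun p hp => if_pos hp
  have hf₂ : ∀ p ∈ P₂, f p = x₀ := fun p hp => by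
    have hp' : ‖p.1‖ ≤ 1 / 2 := hp
    simp only [f]
    rw [if_neg (by linarith), if_pos hp']
  have hf₃ : ∀ p ∈ P₃, f p = H (ν p, τ p) := by
    rintro p ⟨⟨h1, h2, h3⟩, hpA⟩
    rcases h2.eq_or_lt with h2 | h2
    · have hτ0 : τ p = 0 := by simp [τ, h2]
      rw [hf₁ p h2.ge, hτ0, hH0 _ hpA]
      exact (coe_sphereProj_of_norm_eq_one x₀ h2).symm
    rcases h1.eq_or_lt with h1 | h1
    · have hτ1 : τ p = 1 := by simp only [τ, ← h1]; norm_num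
      rw [hf₂ p h1.ge, hτ1, hH1 _ hpA]
    · simp only [f]
      rw [if_neg (by linarith), if_neg (by linarith)]
  have hfc : ContinuousOn f (P₁ ∪ P₂ ∪ P₃) := by
    refine ((continuous_fst.continuousOn.congr hf₁).union_of_isClosed
      (continuousOn_const.congr hf₂) hP₁ hP₂).union_of_isClosed ?_ (hP₁.union hP₂) hP₃
    refine ContinuousOn.congr ?_ hf₃
    refine continuous_subtype_val.comp_continuousOn (hH.comp
      ((hν.mono inter_subset_left).prodMk hτ.continuousOn) ?_)
    exact fun p hp => ⟨hp.2, mem_univ _⟩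
  obtain ⟨F, hF⟩ := ContinuousMap.exists_restrict_eq ((hP₁.union hP₂).union hP₃)
    ⟨(P₁ ∪ P₂ ∪ P₃).domRestrict f, hfc.domRestrict⟩
  have hFf : ∀ p ∈ P₁ ∪ P₂ ∪ P₃, F p = f p := fun p hp => DFunLike.congr_fun hF ⟨p, hp⟩
  have hS : ∀ x : Metric.sphere (0 : E) 1, (x : E) ≠ 0 := fun x => ne_zero_of_mem_unit_sphere x
  refine ⟨F, F.continuous, fun p hp => ?_, fun p hp => ?_, fun p h1 h2 hA => ?_⟩
  · rw [hFf p (Or.inl (Or.inl hp)), hf₁ p hp]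
  · rw [hFf p (Or.inl (Or.inr hp)), hf₂ p hp]
    exact hS _
  · rcases le_total ‖p.1‖ 1 with h3 | h3
    · have hp : p ∈ P₃ := ⟨⟨h1, h3, h2⟩, hA⟩
      rw [hFf p (Or.inr hp), hf₃ p hp]
      exact hS _
    · rw [hFf p (Or.inl (Or.inl h3)), hf₁ p h3]
      exact hne h1

/-- The product of two spheres is not the union of two closed sets such that the first projection
is nullhomotopic on the first one and the second projection is nullhomotopic on the second one. -/
theorem sphere_prod_sphere_ne_union {E : Type*} [NormedAddCommGroup E]
    [InnerProductSpace ℝ E] [FiniteDimensional ℝ E] (x₀ : Metric.sphere (0 : E) 1)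
    {A B : Set (Metric.sphere (0 : E) 1 × Metric.sphere (0 : E) 1)} (hA : IsClosed A)
    (hB : IsClosed B)
    {H K : (Metric.sphere (0 : E) 1 × Metric.sphere (0 : E) 1) × I → Metric.sphere (0 : E) 1}
    (hH : ContinuousOn H (A ×ˢ univ)) (hH0 : ∀ z ∈ A, H (z, 0) = z.1)
    (hH1 : ∀ z ∈ A, H (z, 1) = x₀)
    (hK : ContinuousOn K (B ×ˢ univ)) (hK0 : ∀ z ∈ B, K (z, 0) = z.2)
    (hK1 : ∀ z ∈ B, K (z, 1) = x₀) : A ∪ B ≠ univ := by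
  intro hAB
  obtain ⟨F, hF, hF1, hF2, hF3⟩ := exists_continuous_extension_of_nullhomotopy x₀ hA hH hH0 hH1
  obtain ⟨G, hG, hG1, hG2, hG3⟩ := exists_continuous_extension_of_nullhomotopy x₀
    (A := Prod.swap ⁻¹' B) (H := fun p => K (p.1.swap, p.2)) (hB.preimage continuous_swap)
    (hK.comp (by fun_prop) fun p hp => ⟨hp.1, mem_univ _⟩) (fun z hz => hK0 _ hz)
    (fun z hz => hK1 _ hz)
  obtain ⟨p, hp1, hp2⟩ := exists_prod_eq_zero (F := F) (G := fun p => G p.swap) hF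
    (hG.comp continuous_swap) hF1 (fun p hp => hG1 p.swap hp)
  have h1 : 1 / 2 ≤ ‖p.1‖ := by
    by_contra! h
    exact hF2 p h.le hp1
  have h2 : 1 / 2 ≤ ‖p.2‖ := by
    by_contra! h
    exact hG2 p.swap h.le hp2
  have h3 : (sphereProj x₀ p.1, sphereProj x₀ p.2) ∈ A ∪ B := hAB ▸ mem_univ _
  rcases h3 with h3 | h3
  · exact hF3 p h1 h2 h3 hp1
  · exact hG3 p.swap h2 h1 h3 hp2

namespace BrownSphere

variable {n : ℕ} {x₀ : Metric.sphere (0 : EuclideanSpace ℝ (Fin (n + 1))) 1}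

/-- The quotient map onto the Brown sphere. -/
def proj (x₀ : Metric.sphere (0 : EuclideanSpace ℝ (Fin (n + 1))) 1) :
    ℝ≥0 ⊕ (Metric.sphere (0 : EuclideanSpace ℝ (Fin (n + 1))) 1 × ℕ) → BrownSphere n x₀ :=
  Quot.mk _

/-- The ray of the Brown sphere. -/
def ray (x₀ : Metric.sphere (0 : EuclideanSpace ℝ (Fin (n + 1))) 1) (a : ℝ≥0) :
    BrownSphere n x₀ :=
  proj x₀ (Sum.inl a)

/-- The points of the spheres attached to the ray. -/
def cell (x₀ : Metric.sphere (0 : EuclideanSpace ℝ (Fin (n + 1))) 1)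
    (y : Metric.sphere (0 : EuclideanSpace ℝ (Fin (n + 1))) 1 × ℕ) : BrownSphere n x₀ :=
  proj x₀ (Sum.inr y)

theorem isQuotientMap_proj : Topology.IsQuotientMap (proj x₀) := isQuotientMap_quot_mk

theorem continuous_ray : Continuous (ray x₀) :=
  isQuotientMap_proj.continuous.comp continuous_inl

theorem continuous_cell : Continuous (cell x₀) :=
  isQuotientMap_proj.continuous.comp continuous_inr

theorem cell_base (k : ℕ) : cell x₀ (x₀, k) = ray x₀ k :=
  (Quot.sound ⟨k, rfl, rfl⟩).symm

/-- Maps out of the Brown sphere. -/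
def desc {Y : Type*} (f : ℝ≥0 → Y)
    (g : Metric.sphere (0 : EuclideanSpace ℝ (Fin (n + 1))) 1 × ℕ → Y)
    (hfg : ∀ k : ℕ, f k = g (x₀, k)) : BrownSphere n x₀ → Y :=
  Quot.lift (Sum.elim f g) (by rintro _ _ ⟨k, rfl, rfl⟩; exact hfg k)

theorem continuous_desc {Y : Type*} [TopologicalSpace Y] {f : ℝ≥0 → Y}
    {g : Metric.sphere (0 : EuclideanSpace ℝ (Fin (n + 1))) 1 × ℕ → Y}
    {hfg : ∀ k : ℕ, f k = g (x₀, k)} (hf : Continuous f) (hg : Continuous g) :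
    Continuous (desc f g hfg) :=
  continuous_quot_lift _ (hf.sumElim hg)

/-- The map to the sphere that collapses the ray and is the identity on the `k`-th sphere for every
`k` in `s`, and constant on the other ones. -/
def fold (x₀ : Metric.sphere (0 : EuclideanSpace ℝ (Fin (n + 1))) 1) (s : Set ℕ) :
    BrownSphere n x₀ → Metric.sphere (0 : EuclideanSpace ℝ (Fin (n + 1))) 1 :=
  open Classical in
  desc (fun _ => x₀) (fun y => if y.2 ∈ s then y.1 else x₀) (by simp)

theorem continuous_fold (s : Set ℕ) : Continuous (fold x₀ s) := by
  classical
  refine continuous_desc continuous_const ?_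
  rw [continuous_prod_of_discrete_right]
  intro k
  by_cases hk : k ∈ s <;> simp [hk, continuous_id', continuous_const]

theorem fold_cell {s : Set ℕ} {k : ℕ} (hk : k ∈ s)
    (x : Metric.sphere (0 : EuclideanSpace ℝ (Fin (n + 1))) 1) : fold x₀ s (cell x₀ (x, k)) = x :=
  if_pos hk

theorem fold_cell_of_notMem {s : Set ℕ} {k : ℕ} (hk : k ∉ s)
    (x : Metric.sphere (0 : EuclideanSpace ℝ (Fin (n + 1))) 1) : fold x₀ s (cell x₀ (x, k)) = x₀ :=
  if_neg hk

/-- The map to the ray that collapses each sphere to the point where it is attached. -/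
def position (x₀ : Metric.sphere (0 : EuclideanSpace ℝ (Fin (n + 1))) 1) :
    BrownSphere n x₀ → ℝ≥0 :=
  desc id (fun y => (y.2 : ℝ≥0)) (by simp)

theorem continuous_position : Continuous (position x₀) :=
  continuous_desc continuous_id (by fun_prop)

@[simp]
theorem position_ray (a : ℝ≥0) : position x₀ (ray x₀ a) = a := rfl

theorem isCompact_position_le (m : ℝ≥0) : IsCompact {p | position x₀ p ≤ m} := by
  have h1 : IsCompact (ray x₀ '' Icc 0 m) := isCompact_Icc.image continuous_ray
  have h2 : IsCompact (cell x₀ '' (univ ×ˢ {k : ℕ | (k : ℝ≥0) ≤ m})) := by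
    refine (isCompact_univ.prod (Set.Finite.isCompact ?_)).image continuous_cell
    obtain ⟨N, hN⟩ := exists_nat_ge m
    exact (finite_Iic N).subset fun k hk => by
      have : (k : ℝ≥0) ≤ N := le_trans hk hN
      exact_mod_cast this
  refine (h1.union h2).of_isClosed_subset (isClosed_le continuous_position continuous_const) ?_
  intro p hp
  obtain ⟨z | y, rfl⟩ := isQuotientMap_proj.surjective p
  · exact Or.inl ⟨z, ⟨zero_le, hp⟩, rfl⟩
  · exact Or.inr ⟨y, ⟨mem_univ _, hp⟩, rfl⟩

theorem not_PTCLE_of_le_one {m : ℕ} (hm : m ≤ 1) : ¬ PTCLE (BrownSphere n x₀) m := by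
  classical
  rintro ⟨U, hUo, hU, s, hs, hends, -⟩
  let φ : Metric.sphere (0 : EuclideanSpace ℝ (Fin (n + 1))) 1 ×
      Metric.sphere (0 : EuclideanSpace ℝ (Fin (n + 1))) 1 → BrownSphere n x₀ × BrownSphere n x₀ :=
    fun z => (cell x₀ (z.1, 0), cell x₀ (z.2, 1))
  have hφ : Continuous φ :=
    (continuous_cell.comp (by fun_prop)).prodMk (continuous_cell.comp (by fun_prop))
  obtain ⟨A, hA, hAc, hAU⟩ := exists_iUnion_eq_closed_subset (u := fun i => φ ⁻¹' U i)
    (fun i => (hUo i).preimage hφ) (fun _ => toFinite _)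
    (by rw [← preimage_iUnion, hU, preimage_univ])
  let h (i : Fin (m + 1)) (k : ℕ) (t : I → I)
      (p : (Metric.sphere (0 : EuclideanSpace ℝ (Fin (n + 1))) 1 ×
        Metric.sphere (0 : EuclideanSpace ℝ (Fin (n + 1))) 1) × I) :
      Metric.sphere (0 : EuclideanSpace ℝ (Fin (n + 1))) 1 :=
    if hp : φ p.1 ∈ U i then fold x₀ {k} (s i ⟨φ p.1, hp⟩ (t p.2)) else x₀
  have hh : ∀ i k t, Continuous t → ContinuousOn (h i k t) (A i ×ˢ univ) := by
    intro i k t ht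
    rw [continuousOn_iff_continuous_domRestrict]
    have h1 : (A i ×ˢ univ).domRestrict (h i k t) = fun p : (A i ×ˢ univ : Set _) =>
        fold x₀ {k} (s i ⟨φ p.1.1, hAU i p.2.1⟩ (t p.1.2)) := by
      funext p
      exact dif_pos (hAU i p.2.1)
    rw [h1]
    refine (continuous_fold _).comp (Continuous.eval ((hs i).comp ?_) (by fun_prop))
    exact Continuous.subtype_mk (by fun_prop) _
  have hval : ∀ i k t z, z ∈ A i → ∀ r, ∃ p : U i, p.1 = φ z ∧
      h i k t (z, r) = fold x₀ {k} (s i p (t r)) :=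
    fun i k t z hz r => ⟨⟨φ z, hAU i hz⟩, rfl, dif_pos (hAU i hz)⟩
  refine sphere_prod_sphere_ne_union x₀ (hAc 0) (hAc (Fin.last m))
    (hh 0 0 id continuous_id) (fun z hz => ?_) (fun z hz => ?_)
    (hh (Fin.last m) 1 unitInterval.symm continuous_symm) (fun z hz => ?_) (fun z hz => ?_) ?_
  · obtain ⟨p, hp, hv⟩ := hval 0 0 id z hz 0
    rw [hv, id, (hends 0 p).1, hp]
    exact fold_cell (by simp) _
  · obtain ⟨p, hp, hv⟩ := hval 0 0 id z hz 1
    rw [hv, id, (hends 0 p).2, hp]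
    exact fold_cell_of_notMem (by simp) _
  · obtain ⟨p, hp, hv⟩ := hval (Fin.last m) 1 unitInterval.symm z hz 0
    rw [hv, unitInterval.symm_zero, (hends _ p).2, hp]
    exact fold_cell (by simp) _
  · obtain ⟨p, hp, hv⟩ := hval (Fin.last m) 1 unitInterval.symm z hz 1
    rw [hv, unitInterval.symm_one, (hends _ p).1, hp]
    exact fold_cell_of_notMem (by simp) _
  · refine eq_univ_of_univ_subset (hA ▸ iUnion_subset fun i => ?_)
    have : i = 0 ∨ i = Fin.last m := by
      rw [Fin.ext_iff, Fin.ext_iff, Fin.val_last, Fin.val_zero]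
      omega
    rcases this with rfl | rfl
    · exact subset_union_left
    · exact subset_union_right

end BrownSphere

/-- The subset `O` of `X` can be contracted to `x₀` inside `X`. The contraction is extended to all
of `X`, with no continuity outside `O`, in such a way that `x₀` does not move. -/
def ContractsTo {X : Type*} [TopologicalSpace X] (x₀ : X) (O : Set X) : Prop :=
  ∃ h : X × I → X, ContinuousOn h (O ×ˢ univ) ∧ (∀ x ∈ O, h (x, 0) = x ∧ h (x, 1) = x₀) ∧
    ∀ t, h (x₀, t) = x₀

namespace ContractsTo

variable {X : Type*} [TopologicalSpace X] {x₀ : X} {O O' : Set X}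

theorem mono (h : ContractsTo x₀ O) (hO : O' ⊆ O) : ContractsTo x₀ O' := by
  obtain ⟨f, hf, hf', hf₀⟩ := h
  exact ⟨f, hf.mono (prod_mono hO subset_rfl), fun x hx => hf' x (hO hx), hf₀⟩

theorem union (h : ContractsTo x₀ O) (h' : ContractsTo x₀ O') (hO : IsOpen O) (hO' : IsOpen O')
    (hd : Disjoint O O') : ContractsTo x₀ (O ∪ O') := by
  classical
  obtain ⟨f, hf, hf', hf₀⟩ := h
  obtain ⟨g, hg, hg', hg₀⟩ := h'
  have hn : ∀ x ∈ O', x ∉ O := fun x hx hx' => disjoint_left.1 hd hx' hx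
  refine ⟨fun p => if p.1 ∈ O then f p else g p, ?_, ?_, ?_⟩
  · rw [union_prod]
    refine ContinuousOn.union_continuousAt (hO.prod isOpen_univ)
      (hf.congr fun p hp => if_pos hp.1) fun p hp => ?_
    exact (hg.congr fun p hp => if_neg (hn _ hp.1)).continuousAt
      ((hO'.prod isOpen_univ).mem_nhds hp)
  · rintro x (hx | hx)
    · simpa [hx] using hf' x hx
    · simpa [hn x hx] using hg' x hx
  · intro t
    simp only [hf₀, hg₀, ite_self]

theorem of_path (hx₀ : x₀ ∉ O) (γ : ∀ x : O, Path (x : X) x₀) (hγ : Continuous ↿γ) :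
    ContractsTo x₀ O := by
  classical
  refine ⟨fun p => if hp : p.1 ∈ O then γ ⟨p.1, hp⟩ p.2 else x₀, ?_, fun x hx => ?_, ?_⟩
  · rw [continuousOn_iff_continuous_domRestrict]
    have h : (O ×ˢ univ).domRestrict (fun p : X × I =>
        if hp : p.1 ∈ O then γ ⟨p.1, hp⟩ p.2 else x₀) =
        ↿γ ∘ fun p : (O ×ˢ univ : Set (X × I)) => ((⟨p.1.1, p.2.1⟩ : O), p.1.2) := by
      funext p
      exact dif_pos p.2.1
    rw [h]
    exact hγ.comp ((Continuous.subtype_mk (by fun_prop) _).prodMk (by fun_prop))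
  · simp [hx]
  · simp [hx₀]

end ContractsTo

section SphereContraction

variable {E : Type*} [NormedAddCommGroup E] [NormedSpace ℝ E]

theorem segment_ne_zero {x y : Metric.sphere (0 : E) 1} (hxy : x ≠ -y) (t : ℝ) (h0 : 0 ≤ t)
    (h1 : t ≤ 1) : (1 - t) • (x : E) + t • (y : E) ≠ 0 := by
  intro h
  have h2 := eq_neg_of_add_eq_zero_left h
  have h3 := congrArg norm h2
  rw [norm_neg, norm_smul, norm_smul, mem_sphere_zero_iff_norm.1 x.2,
    mem_sphere_zero_iff_norm.1 y.2, mul_one, mul_one, Real.norm_of_nonneg h0,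
    Real.norm_of_nonneg (by linarith)] at h3
  have h4 : t = 1 / 2 := by linarith
  subst h4
  refine hxy (Subtype.ext ?_)
  have h5 : (1 / 2 : ℝ) • (x : E) = (1 / 2 : ℝ) • (-(y : E)) := by
    rw [smul_neg, ← h2]; norm_num
  simpa using smul_right_injective E (by norm_num : (1 / 2 : ℝ) ≠ 0) h5

theorem continuous_sphereProj_segment (y : Metric.sphere (0 : E) 1) :
    Continuous fun p : {x : Metric.sphere (0 : E) 1 // x ≠ -y} × I =>
      sphereProj y ((1 - (p.2 : ℝ)) • (p.1 : E) + (p.2 : ℝ) • (y : E)) :=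
  (continuousOn_sphereProj y).comp_continuous (by fun_prop)
    fun p => segment_ne_zero p.1.2 _ p.2.2.1 p.2.2.2

theorem contractsTo_ne_neg (x₀ : Metric.sphere (0 : E) 1) : ContractsTo x₀ {x | x ≠ -x₀} := by
  refine ⟨fun p => sphereProj x₀ ((1 - (p.2 : ℝ)) • (p.1 : E) + (p.2 : ℝ) • (x₀ : E)), ?_, ?_, ?_⟩
  · refine (continuousOn_sphereProj x₀).comp (by fun_prop) fun p hp => ?_
    exact segment_ne_zero hp.1 _ p.2.2.1 p.2.2.2
  · intro x _
    simp [sphereProj_coe]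
  · intro t
    dsimp only
    rw [← add_smul, sub_add_cancel, one_smul, sphereProj_coe]

theorem contractsTo_ne (hE : 1 < Module.rank ℝ E) (x₀ : Metric.sphere (0 : E) 1) :
    ContractsTo x₀ {x | x ≠ x₀} := by
  have : PathConnectedSpace (Metric.sphere (0 : E) 1) :=
    isPathConnected_iff_pathConnectedSpace.1 (isPathConnected_sphere hE 0 zero_le_one)
  have hne : ∀ x : {x : Metric.sphere (0 : E) 1 | x ≠ x₀}, x.1 ≠ - -x₀ := fun x => by
    rw [neg_neg]
    exact x.2
  let γ (x : {x : Metric.sphere (0 : E) 1 | x ≠ x₀}) : Path (x : Metric.sphere (0 : E) 1) (-x₀) :=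
    { toFun := fun t => sphereProj (-x₀)
        ((1 - (t : ℝ)) • ((x : Metric.sphere (0 : E) 1) : E) +
          (t : ℝ) • ((-x₀ : Metric.sphere (0 : E) 1) : E))
      continuous_toFun := (continuous_sphereProj_segment (-x₀)).comp
        (f := fun t : I => ((⟨x.1, hne x⟩ : {x : Metric.sphere (0 : E) 1 // x ≠ - -x₀}), t))
        (.prodMk continuous_const continuous_id)
      source' := by simp [sphereProj_coe]
      target' := by
        rw [Icc.coe_one, sub_self, zero_smul, zero_add, one_smul, sphereProj_coe] }
  have hγ : Continuous ↿γ := (continuous_sphereProj_segment (-x₀)).comp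
    (f := fun p : {x : Metric.sphere (0 : E) 1 | x ≠ x₀} × I =>
      ((⟨p.1.1, hne p.1⟩ : {x : Metric.sphere (0 : E) 1 // x ≠ - -x₀}), p.2))
    ((Continuous.subtype_mk (by fun_prop) _).prodMk continuous_snd)
  let δ := PathConnectedSpace.somePath (-x₀) x₀
  have hδ : Continuous ↿(fun _ : {x : Metric.sphere (0 : E) 1 | x ≠ x₀} => δ) :=
    δ.continuous.comp continuous_snd
  exact .of_path (by simp) (fun x => (γ x).trans δ) (Path.trans_continuous_family _ hγ _ hδ)

end SphereContraction

theorem contractsTo_inner_ne_zero {E : Type*} [NormedAddCommGroup E] [InnerProductSpace ℝ E]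
    (hE : 1 < Module.rank ℝ E) (x₀ : Metric.sphere (0 : E) 1) :
    ContractsTo x₀ {x | inner ℝ (x : E) (x₀ : E) ≠ 0} := by
  have h : inner ℝ (x₀ : E) (x₀ : E) = 1 :=
    inner_self_eq_one_of_norm_eq_one (mem_sphere_zero_iff_norm.1 x₀.2)
  have hc : Continuous fun x : Metric.sphere (0 : E) 1 => inner ℝ (x : E) (x₀ : E) := by fun_prop
  refine (ContractsTo.union (O := {x : Metric.sphere (0 : E) 1 | 0 < inner ℝ (x : E) (x₀ : E)})
    (O' := {x : Metric.sphere (0 : E) 1 | inner ℝ (x : E) (x₀ : E) < 0})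
    ((contractsTo_ne_neg x₀).mono ?_) ((contractsTo_ne hE x₀).mono ?_)
    (isOpen_lt continuous_const hc) (isOpen_lt hc continuous_const)
    ?_).mono fun x hx => (lt_or_gt_of_ne hx).symm
  · rintro x hx rfl
    rw [mem_ofPred_eq, coe_neg_sphere, inner_neg_left, h] at hx
    linarith
  · rintro x hx rfl
    rw [mem_ofPred_eq, h] at hx
    linarith
  · refine disjoint_left.2 fun x hx hx' => ?_
    rw [mem_ofPred_eq] at hx hx'
    exact lt_asymm hx hx'

/-- The sphere has three open sets that contract to the base point and cover it pairwise. -/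
theorem exists_open_contractsTo {E : Type*} [NormedAddCommGroup E] [InnerProductSpace ℝ E]
    (hE : 1 < Module.rank ℝ E) (x₀ : Metric.sphere (0 : E) 1) :
    ∃ O : Fin 3 → Set (Metric.sphere (0 : E) 1),
      (∀ i, IsOpen (O i)) ∧ (∀ i, ContractsTo x₀ (O i)) ∧ ∀ i j, i ≠ j → O i ∪ O j = univ := by
  have h : inner ℝ (x₀ : E) (x₀ : E) = 1 :=
    inner_self_eq_one_of_norm_eq_one (mem_sphere_zero_iff_norm.1 x₀.2)
  have hx₀ : x₀ ≠ -x₀ := ne_neg_of_mem_unit_sphere ℝ x₀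
  refine ⟨![{x | x ≠ -x₀}, {x | x ≠ x₀}, {x | inner ℝ (x : E) (x₀ : E) ≠ 0}], ?_, ?_, ?_⟩
  · simp only [Fin.forall_fin_succ]
    exact ⟨isOpen_ne, isOpen_ne, isOpen_ne_fun (by fun_prop) (by fun_prop), fun i => i.elim0⟩
  · simp only [Fin.forall_fin_succ]
    exact ⟨contractsTo_ne_neg x₀, contractsTo_ne hE x₀, contractsTo_inner_ne_zero hE x₀,
      fun i => i.elim0⟩
  · have h01 : {x | x ≠ -x₀} ∪ {x | x ≠ x₀} = univ := eq_univ_of_forall fun x =>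
      or_iff_not_imp_left.2 fun hx => by rw [not_not.1 hx]; exact hx₀.symm
    have h02 : {x | x ≠ -x₀} ∪
        {x : Metric.sphere (0 : E) 1 | inner ℝ (x : E) (x₀ : E) ≠ 0} = univ :=
      eq_univ_of_forall fun x => or_iff_not_imp_left.2 fun hx => by simp [not_not.1 hx]
    have h12 : {x | x ≠ x₀} ∪ {x : Metric.sphere (0 : E) 1 | inner ℝ (x : E) (x₀ : E) ≠ 0} = univ :=
      eq_univ_of_forall fun x => or_iff_not_imp_left.2 fun hx => by simp [not_not.1 hx]
    intro i j hij
    fin_cases i <;> fin_cases j <;> first | exact absurd rfl hij | assumption |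
      (rw [union_comm]; assumption)

theorem Topology.IsQuotientMap.prodMap_id {X Y Z : Type*} [TopologicalSpace X] [TopologicalSpace Y]
    [TopologicalSpace Z] [LocallyCompactSpace Z] {f : X → Y} (hf : Topology.IsQuotientMap f) :
    Topology.IsQuotientMap (Prod.map f (id : Z → Z)) := by
  refine ⟨.of_isOpen_preimage_iff_isOpen fun s => ⟨fun hs => ?_,
    fun hs => hs.preimage (hf.continuous.prodMap continuous_id)⟩,
    hf.surjective.prodMap Function.surjective_id⟩
  rw [isOpen_iff_continuous_mem] at hs ⊢
  exact hf.continuous_lift_prod_left hs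

namespace BrownSphere

variable {n : ℕ} {x₀ : Metric.sphere (0 : EuclideanSpace ℝ (Fin (n + 1))) 1}

/-- A contraction on the spheres that fixes the base point acts on the Brown sphere, keeping the ray
pointwise fixed. -/
theorem exists_contraction {O : Set (Metric.sphere (0 : EuclideanSpace ℝ (Fin (n + 1))) 1)}
    (hO : IsOpen O) (h : ContractsTo x₀ O) :
    ∃ D : BrownSphere n x₀ × I → BrownSphere n x₀,
      ContinuousOn D ((fold x₀ univ ⁻¹' O) ×ˢ univ) ∧
      (∀ p ∈ fold x₀ univ ⁻¹' O, D (p, 0) = p ∧ D (p, 1) = ray x₀ (position x₀ p)) ∧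
      ∀ p t, position x₀ (D (p, t)) = position x₀ p := by
  obtain ⟨h, hc, hh, h₀⟩ := h
  let D (p : BrownSphere n x₀ × I) : BrownSphere n x₀ :=
    desc (x₀ := x₀) (ray x₀) (fun y => cell x₀ (h (y.1, p.2), y.2))
      (fun k => by rw [h₀, cell_base]) p.1
  have hfO : IsOpen ((fold x₀ univ ⁻¹' O) ×ˢ (univ : Set I)) :=
    (hO.preimage (continuous_fold univ)).prod isOpen_univ
  refine ⟨D, ?_, fun p hp => ?_, fun p t => ?_⟩
  · rw [(isQuotientMap_proj.prodMap_id (Z := I)).continuousOn_isOpen_iff hfO]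
    refine continuousOn_of_forall_continuousAt ?_
    rintro ⟨z | ⟨x, k⟩, t⟩ hz
    · refine ((Topology.IsOpenEmbedding.inl.prodMap .id).continuousAt_iff (x := (z, t))).1 ?_
      exact (continuous_ray.comp continuous_fst).continuousAt
    · refine ((Topology.IsOpenEmbedding.inr.prodMap .id).continuousAt_iff (x := ((x, k), t))).1 ?_
      refine continuous_cell.continuousAt.comp (f := fun y :
        (Metric.sphere (0 : EuclideanSpace ℝ (Fin (n + 1))) 1 × ℕ) × I => (h (y.1.1, y.2), y.1.2))
        (ContinuousAt.prodMk ?_ (by fun_prop))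
      have hx : (x, t) ∈ O ×ˢ (univ : Set I) := by
        refine ⟨?_, mem_univ _⟩
        have := hz.1
        rwa [← fold_cell (x₀ := x₀) (mem_univ k) x]
      exact ContinuousAt.comp (g := h) (f := fun y :
        (Metric.sphere (0 : EuclideanSpace ℝ (Fin (n + 1))) 1 × ℕ) × I => (y.1.1, y.2))
        (hc.continuousAt ((hO.prod isOpen_univ).mem_nhds hx)) (by fun_prop)
  · obtain ⟨z | ⟨x, k⟩, rfl⟩ := isQuotientMap_proj.surjective p
    · exact ⟨rfl, rfl⟩
    · have hx : x ∈ O := by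
        rw [← fold_cell (x₀ := x₀) (mem_univ k) x]
        exact hp
      refine ⟨congrArg (fun y => cell x₀ (y, k)) (hh x hx).1,
        (congrArg (fun y => cell x₀ (y, k)) (hh x hx).2).trans (cell_base k)⟩
  · obtain ⟨z | ⟨x, k⟩, rfl⟩ := isQuotientMap_proj.surjective p <;> rfl

/-- The path along the ray between two of its points. -/
def rayPath (x₀ : Metric.sphere (0 : EuclideanSpace ℝ (Fin (n + 1))) 1) (a b : ℝ≥0) :
    Path (ray x₀ a) (ray x₀ b) where
  toFun t := ray x₀ (toNNReal (σ t) * a + toNNReal t * b)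
  continuous_toFun := continuous_ray.comp (by fun_prop)
  source' := by simp
  target' := by simp

theorem le_position_rayPath {a b m : ℝ≥0} (ha : m ≤ a) (hb : m ≤ b) (t : I) :
    m ≤ position x₀ (rayPath x₀ a b t) := by
  calc m = toNNReal (σ t) * m + toNNReal t * m := by
        rw [← add_mul, toNNReal_symm_add_toNNReal, one_mul]
    _ ≤ toNNReal (σ t) * a + toNNReal t * b := by gcongr

/-- Over the pairs of points lying in the domain of a contraction there is a continuous choice of
paths that do not come closer to the beginning of the ray than their endpoints. -/
theorem exists_paths {O : Set (Metric.sphere (0 : EuclideanSpace ℝ (Fin (n + 1))) 1)}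
    (hO : IsOpen O) (h : ContractsTo x₀ O) {W : Set (BrownSphere n x₀ × BrownSphere n x₀)}
    (hW : ∀ z ∈ W, fold x₀ univ z.1 ∈ O ∧ fold x₀ univ z.2 ∈ O) :
    ∃ s : W → C(I, BrownSphere n x₀), Continuous s ∧
      (∀ z : W, s z 0 = z.1.1 ∧ s z 1 = z.1.2) ∧
      ∀ (z : W) (m : ℝ≥0), m ≤ position x₀ z.1.1 → m ≤ position x₀ z.1.2 →
        ∀ t, m ≤ position x₀ (s z t) := by
  obtain ⟨D, hc, hD, hpos⟩ := exists_contraction hO h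
  let γ (p : fold x₀ univ ⁻¹' O) : Path (p : BrownSphere n x₀) (ray x₀ (position x₀ p)) :=
    { toFun := fun t => D (p, t)
      continuous_toFun := hc.comp_continuous (by fun_prop) fun t => ⟨p.2, mem_univ _⟩
      source' := (hD p p.2).1
      target' := (hD p p.2).2 }
  have hγ : Continuous ↿γ := hc.comp_continuous
    (f := fun p : (fold x₀ univ ⁻¹' O) × I => ((p.1 : BrownSphere n x₀), p.2)) (by fun_prop)
    fun p => ⟨p.1.2, mem_univ _⟩
  let γ₁ (z : W) := γ ⟨z.1.1, (hW z z.2).1⟩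
  let γ₂ (z : W) := rayPath x₀ (position x₀ z.1.1) (position x₀ z.1.2)
  let γ₃ (z : W) := (γ ⟨z.1.2, (hW z z.2).2⟩).symm
  have hγ₁ : Continuous ↿γ₁ := hγ.comp
    (f := fun p : W × I => ((⟨p.1.1.1, (hW p.1 p.1.2).1⟩ : fold x₀ univ ⁻¹' O), p.2))
    ((Continuous.subtype_mk (by fun_prop) _).prodMk continuous_snd)
  have hγ₂ : Continuous ↿γ₂ := by
    have := continuous_position (x₀ := x₀)
    exact continuous_ray.comp (f := fun p : W × I => toNNReal (σ p.2) * position x₀ p.1.1.1 +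
      toNNReal p.2 * position x₀ p.1.1.2) (by fun_prop)
  have hγ₃ : Continuous ↿γ₃ := hγ.comp
    (f := fun p : W × I => ((⟨p.1.1.2, (hW p.1 p.1.2).2⟩ : fold x₀ univ ⁻¹' O), σ p.2))
    ((Continuous.subtype_mk (by fun_prop) _).prodMk (by fun_prop))
  let δ (z : W) := ((γ₁ z).trans (γ₂ z)).trans (γ₃ z)
  have hδ : Continuous ↿δ := Path.trans_continuous_family _
    (Path.trans_continuous_family _ hγ₁ _ hγ₂) _ hγ₃
  refine ⟨fun z => (δ z).toContinuousMap, (ContinuousMap.curry ⟨_, hδ⟩).continuous,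
    fun z => ⟨(δ z).source, (δ z).target⟩, fun z m h₁ h₂ t => ?_⟩
  have ht : δ z t ∈ range (γ₁ z) ∪ range (γ₂ z) ∪ range (γ₃ z) := by
    rw [← Path.trans_range, ← Path.trans_range]
    exact mem_range_self t
  change m ≤ position x₀ (δ z t)
  rcases ht with (⟨r, hr⟩ | ⟨r, hr⟩) | ⟨r, hr⟩
  · rw [← hr]
    exact h₁.trans_eq (hpos _ _).symm
  · rw [← hr]
    exact le_position_rayPath h₁ h₂ r
  · rw [← hr]
    exact h₂.trans_eq (hpos _ _).symm

theorem PTCLE_two (hn : 1 ≤ n) : PTCLE (BrownSphere n x₀) 2 := by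
  have hE : 1 < Module.rank ℝ (EuclideanSpace ℝ (Fin (n + 1))) := by
    rw [← Module.finrank_eq_rank, finrank_euclideanSpace_fin]
    exact_mod_cast (by omega : 1 < n + 1)
  obtain ⟨O, hO, hc, hcover⟩ := exists_open_contractsTo hE x₀
  let W (i : Fin 3) : Set (BrownSphere n x₀ × BrownSphere n x₀) :=
    {z | fold x₀ univ z.1 ∈ O i ∧ fold x₀ univ z.2 ∈ O i}
  choose s hs hends hpos using fun i => exists_paths (hO i) (hc i) (W := W i) fun z hz => hz
  refine ⟨W, fun i => ?_, ?_, s, hs, hends, fun K hK => ?_⟩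
  · exact ((hO i).preimage ((continuous_fold univ).comp continuous_fst)).inter
      ((hO i).preimage ((continuous_fold univ).comp continuous_snd))
  · refine eq_univ_of_forall fun z => ?_
    have key : ∀ x, ∀ i j, i ≠ j → x ∈ O i ∨ x ∈ O j := fun x i j hij =>
      (hcover i j hij).ge (mem_univ x)
    rw [mem_iUnion]
    by_cases h : ∀ i, fold x₀ univ z.1 ∈ O i
    · rcases key (fold x₀ univ z.2) 0 1 (by decide) with h' | h'
      exacts [⟨0, h 0, h'⟩, ⟨1, h 1, h'⟩]
    · obtain ⟨i, hi⟩ := not_forall.1 h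
      obtain ⟨j, k, hij, hik, hjk⟩ : ∃ j k : Fin 3, i ≠ j ∧ i ≠ k ∧ j ≠ k := by
        clear hi
        decide +revert
      rcases key (fold x₀ univ z.2) j k hjk with h' | h'
      exacts [⟨j, (key _ i j hij).resolve_left hi, h'⟩, ⟨k, (key _ i k hik).resolve_left hi, h'⟩]
  · obtain ⟨m, hm⟩ := (hK.image continuous_position).bddAbove
    have hKm : K ⊆ {p | position x₀ p ≤ m} := fun p hp => hm (mem_image_of_mem _ hp)
    refine ⟨_, isCompact_position_le m, hKm, fun i z h₁ h₂ t ht => ?_⟩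
    rw [mem_ofPred_eq, not_le] at h₁ h₂
    have := hpos i z _ (min_le_left _ _) (min_le_right _ _) t
    exact ((lt_min h₁ h₂).trans_le this).not_ge (hKm ht)

end BrownSphere

/-- For every `n ≥ 1`, `pTC (Sⁿ_B) = 2`. -/
theorem pTC_brownSphere (n : ℕ) (hn : 1 ≤ n)
    (x₀ : Metric.sphere (0 : EuclideanSpace ℝ (Fin (n + 1))) 1) :
    pTC (BrownSphere n x₀) = 2 := by
  refine le_antisymm (sInf_le ⟨2, rfl, BrownSphere.PTCLE_two hn⟩) (le_sInf ?_)
  rintro _ ⟨m, rfl, hm⟩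
  by_contra hlt
  have h2 : m < 2 := by exact_mod_cast not_le.1 hlt
  exact BrownSphere.not_PTCLE_of_le_one (Nat.le_of_lt_succ h2) hm

end
end
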